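/- arXiv:2306.07253 — 5 statements merged into one kernel-verified Lean document; each statement's English description precedes it below -/
import Mathlib

section
/- Let 0 < p < 1 and ε > δ > 0 be fixed, m = ⌊pN⌋. Let a = a(n) = α_0(n) − O(1) be an integer sequence with μ_a ≥ n^{1+ε}, and let u* = u*(n) ~ 2 log_b n. Then uniformly over all sequences κ of a-bounded colouring profiles with κ_u = 0 for all u < u*: E_m[X̄_k] ≥ exp( φ̃_δ(κ)·n + O(ln^2 n) ) and E_p[X̄_k] ≥ exp( φ̃_δ(κ)·n + O(ln^2 n) ), where κ = Σ_u κ_u and φ̃_δ(x) = −(1−x)·ln(1−x) − (1 − (ln b / 2)·δ)·x, with 0·ln 0 := 0 when κ = 1. -/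
open Filter
open scoped BigOperators Classical

noncomputable section

/-- The number of edges of a simple graph on `Fin n`. -/
def edgeCount {n : ℕ} (G : SimpleGraph (Fin n)) : ℕ := Nat.card G.edgeSet

/-- Probability of a graph property under the uniform random graph `G(n,m)`. -/
def Pm (n m : ℕ) (E : SimpleGraph (Fin n) → Prop) : ℝ :=
  (Nat.card {G : SimpleGraph (Fin n) // edgeCount G = m ∧ E G} : ℝ) /
    (Nat.card {G : SimpleGraph (Fin n) // edgeCount G = m} : ℝ)

/-- Expectation of a real functional under the uniform random graph `G(n,m)`. -/
def Em (n m : ℕ) (X : SimpleGraph (Fin n) → ℝ) : ℝ :=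
  (∑ᶠ G : {G : SimpleGraph (Fin n) // edgeCount G = m}, X G.1) /
    (Nat.card {G : SimpleGraph (Fin n) // edgeCount G = m} : ℝ)

/-- Probability of a graph property under the binomial random graph `G(n,p)`. -/
def Pp (n : ℕ) (p : ℝ) (E : SimpleGraph (Fin n) → Prop) : ℝ :=
  ∑ᶠ G : SimpleGraph (Fin n),
    (if E G then (1 : ℝ) else 0) * p ^ edgeCount G * (1 - p) ^ (n.choose 2 - edgeCount G)

/-- Expectation of a real functional under the binomial random graph `G(n,p)`. -/
def Ep (n : ℕ) (p : ℝ) (X : SimpleGraph (Fin n) → ℝ) : ℝ :=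
  ∑ᶠ G : SimpleGraph (Fin n),
    X G * p ^ edgeCount G * (1 - p) ^ (n.choose 2 - edgeCount G)

/-- `α₀(n) = 2 log_b n − 2 log_b log_b n + 2 log_b (e/2) + 1`. -/
def alpha0 (b : ℝ) (n : ℕ) : ℝ :=
  2 * Real.logb b n - 2 * Real.logb b (Real.logb b n) + 2 * Real.logb b (Real.exp 1 / 2) + 1

/-- `α(n) = ⌊α₀(n)⌋`. -/
def alphaNat (b : ℝ) (n : ℕ) : ℕ := ⌊alpha0 b n⌋₊

/-- `μ_t = C(n,t) q^{C(t,2)}`, the expected number of independent `t`-sets. -/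
def muExp (q : ℝ) (n t : ℕ) : ℝ := (n.choose t : ℝ) * q ^ t.choose 2

/-- A finset of vertices is independent in `G`. -/
def IndepFinset {n : ℕ} (G : SimpleGraph (Fin n)) (s : Finset (Fin n)) : Prop :=
  ∀ v ∈ s, ∀ w ∈ s, ¬ G.Adj v w

/-- `G` has a proper colouring with `k` colours, all colour classes of size at most `t`. -/
def HasBoundedColouring {n : ℕ} (G : SimpleGraph (Fin n)) (t k : ℕ) : Prop :=
  ∃ C : Fin n → Fin k, (∀ v w, G.Adj v w → C v ≠ C w) ∧
    ∀ c : Fin k, (Finset.univ.filter fun v => C v = c).card ≤ t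

/-- The `t`-bounded chromatic number `χ_t(G)`. -/
def chiBounded {n : ℕ} (G : SimpleGraph (Fin n)) (t : ℕ) : ℕ :=
  sInf {k | HasBoundedColouring G t k}

/-- `G` has an equitable proper colouring with `k` colours. -/
def HasEquitableColouring {n : ℕ} (G : SimpleGraph (Fin n)) (k : ℕ) : Prop :=
  ∃ C : Fin n → Fin k, (∀ v w, G.Adj v w → C v ≠ C w) ∧
    ∀ c c' : Fin k,
      (Finset.univ.filter fun v => C v = c).card ≤
        (Finset.univ.filter fun v => C v = c').card + 1

/-- The equitable chromatic number `χ₌(G)`. -/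
def chiEquitable {n : ℕ} (G : SimpleGraph (Fin n)) : ℕ :=
  sInf {k | HasEquitableColouring G k}

/-- The number of unordered `t`-bounded proper `k`-colourings of `G`, i.e. partitions of the
vertex set into exactly `k` nonempty independent sets, each of size at most `t`. -/
def numUnorderedColourings (n t k : ℕ) (G : SimpleGraph (Fin n)) : ℕ :=
  Set.ncard {Q : Finset (Finset (Fin n)) | Q.card = k ∧
    (∀ s ∈ Q, s.Nonempty ∧ s.card ≤ t ∧ IndepFinset G s) ∧
    (∀ v : Fin n, ∃ s ∈ Q, v ∈ s) ∧
    ∀ s ∈ Q, ∀ s' ∈ Q, s ≠ s' → Disjoint s s'}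

/-- `E_{n,k,t}`: the expected number of unordered `t`-bounded `k`-colourings of `G_{n,1/2}`. -/
def Enkt (n k t : ℕ) : ℝ := Ep n (1/2) fun G => (numUnorderedColourings n t k G : ℝ)

/-- The `t`-bounded first moment threshold `k_t(n)`. -/
def fmThreshold (n t : ℕ) : ℕ := sInf {k | 1 ≤ Enkt n k t}

/-- `P` is a (possibly partial) `k`-colouring profile on `n` vertices. -/
def IsProfile (n k : ℕ) (P : ℕ → ℕ) : Prop :=
  (∀ u, u ∉ Finset.Icc 1 n → P u = 0) ∧
    (∑ u ∈ Finset.Icc 1 n, P u = k) ∧ (∑ u ∈ Finset.Icc 1 n, u * P u ≤ n)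

/-- A colouring profile is complete if its classes use all `n` vertices. -/
def IsCompleteProfile (n : ℕ) (P : ℕ → ℕ) : Prop :=
  ∑ u ∈ Finset.Icc 1 n, u * P u = n

/-- A colouring profile is `t`-bounded if it has no classes of size larger than `t`. -/
def IsBoundedProfile (t : ℕ) (P : ℕ → ℕ) : Prop := ∀ u, t < u → P u = 0

/-- The number of parts of a profile on `n` vertices. -/
def profileParts (n : ℕ) (P : ℕ → ℕ) : ℕ := ∑ u ∈ Finset.Icc 1 n, P u

/-- `X_k`: the number of ordered (partial) proper colourings of `G` with profile `P`:
ordered tuples of pairwise disjoint independent sets, decreasing in size, with exactly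
`P u` parts of size `u` for every `u`. -/
def Xprofile {n : ℕ} (G : SimpleGraph (Fin n)) (P : ℕ → ℕ) : ℕ :=
  Set.ncard {V : Fin (profileParts n P) → Finset (Fin n) |
    (∀ i j, i ≠ j → Disjoint (V i) (V j)) ∧
    (∀ i j, i ≤ j → (V j).card ≤ (V i).card) ∧
    (∀ u : ℕ, (Finset.univ.filter fun i => (V i).card = u).card = P u) ∧
    ∀ i, IndepFinset G (V i)}

/-- `X̄_k = X_k / ∏_u k_u!`: the number of unordered colourings with profile `P`. -/
def Xbar {n : ℕ} (G : SimpleGraph (Fin n)) (P : ℕ → ℕ) : ℝ :=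
  (Xprofile G P : ℝ) / ∏ u ∈ Finset.Icc 1 n, ((P u).factorial : ℝ)

/-- `κ = Σ_u κ_u` where `κ_u = u k_u / n`. -/
def kappaTot (n : ℕ) (P : ℕ → ℕ) : ℝ := ∑ u ∈ Finset.Icc 1 n, (u : ℝ) * P u / n

/-- `m = ⌊p N⌋` with `N = C(n,2)`. -/
def mFloor (p : ℝ) (n : ℕ) : ℕ := ⌊p * (n.choose 2 : ℝ)⌋₊

/-- Definition 2.2: a sequence `P` of complete `a`-bounded colouring profiles is tame. -/
def IsTame (p : ℝ) (a : ℕ → ℕ) (P : ℕ → ℕ → ℕ) : Prop :=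
  (∃ C : ℝ, ∀ᶠ n in atTop, alpha0 (1/(1-p)) n - C ≤ (a n : ℝ)) ∧
  (∀ᶠ n in atTop, a n ≤ alphaNat (1/(1-p)) n) ∧
  (∀ n, IsProfile n (profileParts n (P n)) (P n) ∧ IsCompleteProfile n (P n) ∧
      IsBoundedProfile (a n) (P n)) ∧
  ∃ c : ℝ, c ∈ Set.Ioo (0:ℝ) 1 ∧ ∃ γ : ℕ → ℝ, Monotone γ ∧ Tendsto γ atTop atTop ∧
    (∀ᶠ n in atTop, ∀ u, 1 ≤ u → u ≤ a n →
      (u : ℝ) * P n u / n <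
        (1/(1-p)) ^ (-(((alphaNat (1/(1-p)) n - u : ℕ) : ℝ) *
          γ (alphaNat (1/(1-p)) n - u)))) ∧
    ∀ ε : ℝ, 0 < ε → ∀ᶠ n : ℕ in atTop,
      Real.exp (-ε * (n : ℝ) ^ ((1:ℝ) - c)) ≤ Em n (mFloor p n) fun G => Xbar G (P n)

/-- The function `φ(κ)` from Lemma 3.3. -/
def phiProfile (p : ℝ) (n : ℕ) (P : ℕ → ℕ) : ℝ :=
  -(1 - kappaTot n P) * Real.log (1 - kappaTot n P) +
    Real.log (1/(1-p)) / 2 * ∑ u ∈ Finset.Icc 1 n,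
      ((u : ℝ) * P u / n) * (alpha0 (1/(1-p)) n - 1 - 2 / Real.log (1/(1-p)) - (u : ℝ))

/-- The function `φ̃_δ(x)` from Lemma 3.5. -/
def phiTilde (p δ x : ℝ) : ℝ :=
  -(1 - x) * Real.log (1 - x) - (1 - Real.log (1/(1-p)) / 2 * δ) * x

/-- `d_u = 2^{C(u,2)} u!`. -/
def dcoef (u : ℕ) : ℝ := 2 ^ u.choose 2 * (u.factorial : ℝ)

/-- `L_0(n,k,t)`: the supremum of `L_k` over real-valued `t`-bounded complete profiles. -/
def L0 (n k t : ℕ) : ℝ :=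
  sSup {y : ℝ | ∃ f : ℕ → ℝ, (∀ u ∈ Finset.Icc 1 t, 0 ≤ f u) ∧
    (∑ u ∈ Finset.Icc 1 t, f u = (k : ℝ)) ∧ (∑ u ∈ Finset.Icc 1 t, (u : ℝ) * f u = (n : ℝ)) ∧
    y = (n : ℝ) * Real.log n - (n : ℝ) + (k : ℝ) -
      ∑ u ∈ Finset.Icc 1 t, f u * Real.log (f u * dcoef u)}

/-- Membership in `P_{n,k,t}`: a `t`-bounded complete `k`-colouring profile on `n` vertices. -/
def IsKTProfile (n k t : ℕ) (P : ℕ → ℕ) : Prop :=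
  (∀ u, u ∉ Finset.Icc 1 t → P u = 0) ∧
    (∑ u ∈ Finset.Icc 1 t, P u = k) ∧ (∑ u ∈ Finset.Icc 1 t, u * P u = n)

/-- `E_{n,k,t}` written as the sum over profiles of `E_{1/2}[X̄_k]`. -/
def EnktSum (n k t : ℕ) : ℝ :=
  ∑ᶠ P : ℕ → ℕ, if IsKTProfile n k t P then Ep n (1/2) fun G => Xbar G P else 0


namespace ELB

/-- Sum over graphs equals sum over edge sets. -/
lemma sum_graphs (n : ℕ) (h : Finset (Sym2 (Fin n)) → ℝ) :
    ∑ G : SimpleGraph (Fin n), h G.edgeFinset =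
      ∑ T ∈ (⊤ : SimpleGraph (Fin n)).edgeFinset.powerset, h T := by
  refine Finset.sum_bij' (fun G _ => G.edgeFinset)
    (fun T _ => SimpleGraph.fromEdgeSet (T : Set (Sym2 (Fin n)))) ?_ ?_ ?_ ?_ ?_
  · intro G _
    rw [Finset.mem_powerset]
    exact SimpleGraph.edgeFinset_mono le_top
  · intro T _; exact Finset.mem_univ _
  · intro G _
    simp
  · intro T hT
    rw [Finset.mem_powerset] at hT
    ext e
    simp only [SimpleGraph.mem_edgeFinset, SimpleGraph.edgeSet_fromEdgeSet, Set.mem_sdiff,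
      Finset.mem_coe]
    constructor
    · exact fun h => h.1
    · intro he
      refine ⟨he, ?_⟩
      have := hT he
      rw [SimpleGraph.mem_edgeFinset] at this
      simpa using this
  · intro G _; rfl

lemma edgeCount_eq {n : ℕ} (G : SimpleGraph (Fin n)) : edgeCount G = G.edgeFinset.card := by
  rw [edgeCount, Nat.card_eq_fintype_card, SimpleGraph.edgeFinset_card]

lemma card_top (n : ℕ) : (⊤ : SimpleGraph (Fin n)).edgeFinset.card = n.choose 2 := by
  have := SimpleGraph.card_edgeFinset_top_eq_card_choose_two (V := Fin n)
  rw [Fintype.card_fin] at this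
  convert this

/-- forbidden edges of a tuple -/
def forb {n k : ℕ} (V : Fin k → Finset (Fin n)) : Finset (Sym2 (Fin n)) :=
  Finset.univ.biUnion fun i => (V i).offDiag.image Sym2.mk.uncurry

def allow {n k : ℕ} (V : Fin k → Finset (Fin n)) : Finset (Sym2 (Fin n)) :=
  (⊤ : SimpleGraph (Fin n)).edgeFinset \ forb V

lemma card_forb {n k : ℕ} (V : Fin k → Finset (Fin n)) :
    (forb V).card ≤ ∑ i, (V i).card.choose 2 := by
  refine Finset.card_biUnion_le.trans (Finset.sum_le_sum fun i _ => ?_)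
  rw [Sym2.card_image_offDiag]

lemma card_allow {n k : ℕ} (V : Fin k → Finset (Fin n)) :
    n.choose 2 - ∑ i, (V i).card.choose 2 ≤ (allow V).card := by
  have h1 := Finset.le_card_sdiff (forb V) (⊤ : SimpleGraph (Fin n)).edgeFinset
  have h2 := card_forb V
  rw [card_top] at h1
  unfold allow
  omega

lemma card_allow_le {n k : ℕ} (V : Fin k → Finset (Fin n)) :
    (allow V).card ≤ n.choose 2 := by
  rw [← card_top]; exact Finset.card_le_card Finset.sdiff_subset

lemma indep_of_subset {n k : ℕ} (V : Fin k → Finset (Fin n)) (G : SimpleGraph (Fin n))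
    (h : G.edgeFinset ⊆ allow V) (i : Fin k) : IndepFinset G (V i) := by
  intro v hv w hw hvw
  have h1 : s(v, w) ∈ G.edgeFinset := by simpa using hvw
  have h2 := h h1
  rw [allow, Finset.mem_sdiff] at h2
  apply h2.2
  rw [forb, Finset.mem_biUnion]
  refine ⟨i, Finset.mem_univ _, ?_⟩
  rw [Finset.mem_image]
  exact ⟨(v, w), by simp [hv, hw, hvw.ne], rfl⟩

/-- tuples with given profile -/
def tuples (n : ℕ) (P : ℕ → ℕ) : Finset (Fin (profileParts n P) → Finset (Fin n)) :=
  Finset.univ.filter fun V => (∀ i j, i ≠ j → Disjoint (V i) (V j)) ∧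
    (∀ i j, i ≤ j → (V j).card ≤ (V i).card) ∧
    (∀ u : ℕ, (Finset.univ.filter fun i => (V i).card = u).card = P u)

lemma Xprofile_ge {n : ℕ} (G : SimpleGraph (Fin n)) (P : ℕ → ℕ) :
    ∑ V ∈ tuples n P, (if G.edgeFinset ⊆ allow V then (1:ℝ) else 0) ≤ Xprofile G P := by
  rw [Finset.sum_boole]
  norm_cast
  rw [Xprofile, ← Set.ncard_coe_finset]
  apply Set.ncard_le_ncard _ (Set.toFinite _)
  intro V hV
  simp only [tuples, Finset.coe_filter, Finset.mem_filter, Finset.mem_univ, true_and,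
    Set.mem_ofPred_eq] at hV ⊢
  exact ⟨hV.1.1, hV.1.2.1, hV.1.2.2, indep_of_subset V G hV.2⟩

lemma prod_fact_pos (n : ℕ) (P : ℕ → ℕ) :
    (0:ℝ) < ∏ u ∈ Finset.Icc 1 n, ((P u).factorial : ℝ) :=
  Finset.prod_pos fun u _ => by exact_mod_cast Nat.factorial_pos _

lemma Ep_mono {n : ℕ} {p : ℝ} (h0 : 0 ≤ p) (h1 : p ≤ 1) {X Y : SimpleGraph (Fin n) → ℝ}
    (h : ∀ G, X G ≤ Y G) : Ep n p X ≤ Ep n p Y := by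
  unfold Ep
  rw [finsum_eq_sum_of_fintype, finsum_eq_sum_of_fintype]
  have : 0 ≤ 1 - p := by linarith
  gcongr with G
  exact h G

lemma Em_mono {n m : ℕ} {X Y : SimpleGraph (Fin n) → ℝ}
    (h : ∀ G, X G ≤ Y G) : Em n m X ≤ Em n m Y := by
  unfold Em
  rw [finsum_eq_sum_of_fintype, finsum_eq_sum_of_fintype]
  gcongr with G
  exact h G

lemma Ep_ind {n k : ℕ} {p : ℝ} (V : Fin k → Finset (Fin n)) :
    Ep n p (fun G => if G.edgeFinset ⊆ allow V then (1:ℝ) else 0) =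
      (1 - p) ^ (n.choose 2 - (allow V).card) := by
  unfold Ep
  rw [finsum_eq_sum_of_fintype]
  have := sum_graphs n (fun T => (if T ⊆ allow V then (1:ℝ) else 0) * p ^ T.card *
    (1 - p) ^ (n.choose 2 - T.card))
  simp only [edgeCount_eq]
  rw [this]
  have hsub : (allow V).powerset ⊆ (⊤ : SimpleGraph (Fin n)).edgeFinset.powerset :=
    Finset.powerset_mono.2 Finset.sdiff_subset
  rw [← Finset.sum_subset hsub]
  · have h2 : ∀ T ∈ (allow V).powerset, (if T ⊆ allow V then (1:ℝ) else 0) * p ^ T.card *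
      (1 - p) ^ (n.choose 2 - T.card) =
        (1 - p) ^ (n.choose 2 - (allow V).card) *
        (p ^ T.card * (1-p) ^ ((allow V).card - T.card)) := by
      intro T hT
      rw [Finset.mem_powerset] at hT
      have h3 := Finset.card_le_card hT
      have h4 := card_allow_le V
      rw [if_pos hT, one_mul, show n.choose 2 - T.card =
        (n.choose 2 - (allow V).card) + ((allow V).card - T.card) by omega, pow_add]
      ring
    rw [Finset.sum_congr rfl h2, ← Finset.mul_sum, Finset.sum_pow_mul_eq_add_pow]
    simp
  · intro T _ hT
    rw [Finset.mem_powerset] at hT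
    simp [hT]

lemma Em_ind {n k m : ℕ} (V : Fin k → Finset (Fin n)) :
    Em n m (fun G => if G.edgeFinset ⊆ allow V then (1:ℝ) else 0) =
      ((allow V).card.choose m : ℝ) / ((n.choose 2).choose m : ℝ) := by
  have key : ∀ W ⊆ (⊤ : SimpleGraph (Fin n)).edgeFinset,
      ∑ G : SimpleGraph (Fin n), (if edgeCount G = m then
        (if G.edgeFinset ⊆ W then (1:ℝ) else 0) else 0) = (W.card.choose m : ℝ) := by
    intro W hW
    simp only [edgeCount_eq]
    rw [sum_graphs n (fun T => if T.card = m then (if T ⊆ W then (1:ℝ) else 0) else 0)]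
    simp only [← ite_and]
    rw [Finset.sum_boole, ← Finset.card_powersetCard]
    congr 2
    ext T
    simp only [Finset.mem_filter, Finset.mem_powerset, Finset.mem_powersetCard]
    exact ⟨fun h => ⟨h.2.2, h.2.1⟩, fun h => ⟨h.1.trans hW, h.2, h.1⟩⟩
  have sub : ∀ X : SimpleGraph (Fin n) → ℝ,
      ∑ G : {G : SimpleGraph (Fin n) // edgeCount G = m}, X G.1 =
      ∑ G : SimpleGraph (Fin n), (if edgeCount G = m then X G else 0) := by
    intro X
    rw [← Finset.sum_filter, ← Finset.sum_subtype_eq_sum_filter]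
    simp
  have hcard : (Nat.card {G : SimpleGraph (Fin n) // edgeCount G = m} : ℝ) =
      ((n.choose 2).choose m : ℝ) := by
    rw [Nat.card_eq_fintype_card, ← card_top n, ← key _ subset_rfl, ← sub]
    rw [Finset.sum_congr rfl (g := fun _ => (1:ℝ))]
    · simp
    · intro G _
      rw [if_pos]
      exact SimpleGraph.edgeFinset_mono le_top
  unfold Em
  rw [finsum_eq_sum_of_fintype, hcard]
  rw [sub (fun G => if G.edgeFinset ⊆ allow V then (1:ℝ) else 0), key (allow V) Finset.sdiff_subset]

lemma Ep_sum {n : ℕ} {p c : ℝ} {ι : Type*} (S : Finset ι) (X : ι → SimpleGraph (Fin n) → ℝ) :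
    Ep n p (fun G => (∑ V ∈ S, X V G) / c) = (∑ V ∈ S, Ep n p (X V)) / c := by
  unfold Ep
  simp only [finsum_eq_sum_of_fintype]
  rw [Finset.sum_comm, Finset.sum_div]
  refine Finset.sum_congr rfl fun G _ => ?_
  rw [Finset.sum_div, Finset.sum_div, Finset.sum_mul, Finset.sum_mul]
  refine Finset.sum_congr rfl fun G _ => ?_
  ring

lemma Em_sum {n m : ℕ} {c : ℝ} {ι : Type*} (S : Finset ι) (X : ι → SimpleGraph (Fin n) → ℝ) :
    Em n m (fun G => (∑ V ∈ S, X V G) / c) = (∑ V ∈ S, Em n m (X V)) / c := by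
  unfold Em
  simp only [finsum_eq_sum_of_fintype]
  rw [← Finset.sum_div, Finset.sum_comm, ← Finset.sum_div]
  ring

lemma tuples_sum {n : ℕ} {P : ℕ → ℕ} (hP : ∀ u, u ∉ Finset.Icc 1 n → P u = 0)
    (t : Fin (profileParts n P) → ℕ)
    (ht : ∀ u : ℕ, (Finset.univ.filter fun i => t i = u).card = P u) (g : ℕ → ℕ) :
    ∑ i, g (t i) = ∑ u ∈ Finset.Icc 1 n, P u * g u := by
  rw [← Finset.sum_fiberwise_of_maps_to (s := Finset.univ) (t := Finset.Icc 1 n) (g := t)]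
  · refine Finset.sum_congr rfl fun u _ => ?_
    rw [← ht u, Finset.sum_congr rfl (g := fun _ => g u)]
    · simp
    · intro i hi
      rw [(Finset.mem_filter.1 hi).2]
  · intro i _
    by_contra h
    have := hP _ h
    rw [← ht, Finset.card_eq_zero, Finset.filter_eq_empty_iff] at this
    exact this (Finset.mem_univ i) rfl

lemma tuples_prod {n : ℕ} {P : ℕ → ℕ} (hP : ∀ u, u ∉ Finset.Icc 1 n → P u = 0)
    (t : Fin (profileParts n P) → ℕ)
    (ht : ∀ u : ℕ, (Finset.univ.filter fun i => t i = u).card = P u) (g : ℕ → ℕ) :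
    ∏ i, g (t i) = ∏ u ∈ Finset.Icc 1 n, g u ^ P u := by
  rw [← Finset.prod_fiberwise_of_maps_to (s := Finset.univ) (t := Finset.Icc 1 n) (g := t)]
  · refine Finset.prod_congr rfl fun u _ => ?_
    rw [← ht u, Finset.prod_congr rfl (g := fun _ => g u)]
    · simp
    · intro i hi
      rw [(Finset.mem_filter.1 hi).2]
  · intro i _
    by_contra h
    have := hP _ h
    rw [← ht, Finset.card_eq_zero, Finset.filter_eq_empty_iff] at this
    exact this (Finset.mem_univ i) rfl

lemma exists_sizes (n : ℕ) {P : ℕ → ℕ} (hP : ∀ u, u ∉ Finset.Icc 1 n → P u = 0) :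
    ∃ t : Fin (profileParts n P) → ℕ, (∀ i j, i ≤ j → t j ≤ t i) ∧
      ∀ u : ℕ, (Finset.univ.filter fun i => t i = u).card = P u := by
  have e : Fintype.card (Σ u : Finset.Icc 1 n, Fin (P u)) = profileParts n P := by
    rw [Fintype.card_sigma, profileParts]
    simp only [Fintype.card_fin]
    exact Finset.sum_coe_sort (Finset.Icc 1 n) P
  let e' := Fintype.equivFinOfCardEq e
  let t0 : Fin (profileParts n P) → ℕᵒᵈ := fun i => OrderDual.toDual ((e'.symm i).1 : ℕ)
  let σ := Tuple.sort t0
  refine ⟨fun i => OrderDual.ofDual (t0 (σ i)), ?_, ?_⟩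
  · intro i j hij
    exact Tuple.monotone_sort t0 hij
  · intro u
    have h1 : (Finset.univ.filter fun i => OrderDual.ofDual (t0 (σ i)) = u).card =
        (Finset.univ.filter fun x : (Σ u : Finset.Icc 1 n, Fin (P u)) => (x.1 : ℕ) = u).card := by
      refine Finset.card_equiv (σ.trans e'.symm) ?_
      intro i
      rw [Finset.mem_filter, Finset.mem_filter]
      simp [t0]
    rw [h1]
    by_cases hu : u ∈ Finset.Icc 1 n
    · have : (Finset.univ.filter fun x : (Σ u : Finset.Icc 1 n, Fin (P u)) => (x.1 : ℕ) = u) =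
        ({⟨u, hu⟩} : Finset (Finset.Icc 1 n)).sigma (fun u => Finset.univ) := by
        ext x
        simp [Subtype.ext_iff]
      rw [this, Finset.card_sigma]
      simp
    · rw [hP u hu, Finset.card_eq_zero, Finset.filter_eq_empty_iff]
      intro x _ hx
      exact hu (hx ▸ x.1.2)

lemma count_tuples {α : Type*} [Fintype α] [DecidableEq α] (k : ℕ) : ∀ (t : Fin k → ℕ) (A : Finset α),
    ∑ i, t i ≤ A.card →
    A.card.factorial ≤ (Finset.univ.filter fun V : Fin k → Finset α =>
      (∀ i, V i ⊆ A) ∧ (∀ i j, i ≠ j → Disjoint (V i) (V j)) ∧ ∀ i, (V i).card = t i).card *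
      (∏ i, (t i).factorial) * (A.card - ∑ i, t i).factorial := by
  induction k with
  | zero =>
    intro t A _
    have : (Finset.univ.filter fun V : Fin 0 → Finset α =>
      (∀ i, V i ⊆ A) ∧ (∀ i j, i ≠ j → Disjoint (V i) (V j)) ∧ ∀ i, (V i).card = t i).card = 1 := by
      simp
    rw [this]; simp
  | succ k ih =>
    intro t A hA
    rw [Fin.sum_univ_succ] at hA ⊢
    rw [Fin.prod_univ_succ]
    set S := fun B : Finset α => (Finset.univ.filter fun V : Fin k → Finset α =>
      (∀ i, V i ⊆ B) ∧ (∀ i j, i ≠ j → Disjoint (V i) (V j)) ∧ ∀ i, (V i).card = t i.succ) with hS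
    have hle : ((A.powersetCard (t 0)).sigma fun B => S (A \ B)).card ≤
      (Finset.univ.filter fun V : Fin (k+1) → Finset α =>
      (∀ i, V i ⊆ A) ∧ (∀ i j, i ≠ j → Disjoint (V i) (V j)) ∧ ∀ i, (V i).card = t i).card := by
      refine Finset.card_le_card_of_injOn
        (fun x => (Fin.cons x.1 x.2 : Fin (k+1) → Finset α)) ?_ ?_
      · rintro ⟨B, V⟩ hx
        simp only [hS, Finset.coe_sigma, Set.mem_sigma_iff, Finset.mem_coe,
          Finset.mem_powersetCard, Finset.mem_filter, Finset.mem_univ, true_and] at hx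
        obtain ⟨⟨hB, hBc⟩, hV1, hV2, hV3⟩ := hx
        simp only [Finset.coe_filter, Finset.mem_univ, true_and, Set.mem_ofPred_eq]
        have hd : ∀ i, Disjoint B (V i) := fun i =>
          Finset.disjoint_of_subset_right (hV1 i) Finset.disjoint_sdiff
        refine ⟨?_, ?_, ?_⟩
        · intro i
          refine Fin.cases ?_ (fun i => ?_) i
          · simpa using hB
          · simpa using (hV1 i).trans Finset.sdiff_subset
        · intro i j
          refine Fin.cases ?_ (fun i => ?_) i <;> refine Fin.cases ?_ (fun j => ?_) j
          · simp
          · intro _; simpa using hd j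
          · intro _; simpa using (hd i).symm
          · intro hij
            simpa using hV2 i j (fun h => hij (by rw [h]))
        · intro i
          refine Fin.cases ?_ (fun i => ?_) i
          · simpa using hBc
          · simpa using hV3 i
      · rintro ⟨B, V⟩ _ ⟨B', V'⟩ _ h
        have := Fin.cons_injective2 h
        obtain ⟨h1, h2⟩ := this
        simp only at h1 h2
        rw [h1, h2]
    rw [Finset.card_sigma] at hle
    set R := (A.card - (t 0 + ∑ i : Fin k, t i.succ)).factorial
    set Q := ∏ i : Fin k, (t i.succ).factorial
    have h1 : ∀ B ∈ A.powersetCard (t 0), (A.card - t 0).factorial ≤ (S (A \ B)).card * Q * R := by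
      intro B hB
      rw [Finset.mem_powersetCard] at hB
      have hc : (A \ B).card = A.card - t 0 := by rw [Finset.card_sdiff_of_subset hB.1, hB.2]
      have := ih (fun i => t i.succ) (A \ B) (by rw [hc]; omega)
      rw [hc, Nat.sub_sub] at this
      exact this
    have h2 := Finset.sum_le_sum h1
    rw [Finset.sum_const, Finset.card_powersetCard, smul_eq_mul, ← Finset.sum_mul,
      ← Finset.sum_mul] at h2
    have h3 := Nat.choose_mul_factorial_mul_factorial (n := A.card) (k := t 0) (by omega)
    calc A.card.factorial = (A.card.choose (t 0) * (A.card - t 0).factorial) * (t 0).factorial := by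
          rw [← h3]; ring
      _ ≤ ((∑ B ∈ A.powersetCard (t 0), (S (A \ B)).card) * Q * R) * (t 0).factorial := by gcongr
      _ = (∑ B ∈ A.powersetCard (t 0), (S (A \ B)).card) * ((t 0).factorial * Q) * R := by ring
      _ ≤ _ := by gcongr

lemma card_tuples {n : ℕ} {P : ℕ → ℕ} (hP : ∀ u, u ∉ Finset.Icc 1 n → P u = 0)
    (hs : ∑ u ∈ Finset.Icc 1 n, u * P u ≤ n) :
    n.factorial ≤ (tuples n P).card * (∏ u ∈ Finset.Icc 1 n, u.factorial ^ P u) *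
      (n - ∑ u ∈ Finset.Icc 1 n, u * P u).factorial := by
  obtain ⟨t, ht1, ht2⟩ := exists_sizes n hP
  have e1 : ∑ i, t i = ∑ u ∈ Finset.Icc 1 n, u * P u := by
    rw [tuples_sum hP t ht2 (fun u => u)]
    exact Finset.sum_congr rfl fun u _ => mul_comm _ _
  have h := count_tuples (profileParts n P) t (Finset.univ : Finset (Fin n))
    (by rw [e1]; simpa using hs)
  rw [e1, tuples_prod hP t ht2 Nat.factorial] at h
  simp only [Finset.card_univ, Fintype.card_fin] at h
  refine h.trans ?_
  gcongr
  intro V hV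
  rw [Finset.mem_filter] at hV
  replace hV := hV.2
  rw [tuples, Finset.mem_filter]
  refine ⟨Finset.mem_univ _, ?_⟩
  refine ⟨hV.2.1, fun i j hij => ?_, fun u => ?_⟩
  · rw [hV.2.2, hV.2.2]; exact ht1 i j hij
  · simp only [hV.2.2]; exact ht2 u

/-- If each tuple contributes at least `ρ`. -/
lemma Ep_Xbar_ge {n : ℕ} {P : ℕ → ℕ} {p ρ : ℝ} (h0 : 0 ≤ p) (h1 : p ≤ 1)
    (hρ : ∀ V ∈ tuples n P, ρ ≤ Ep n p (fun G => if G.edgeFinset ⊆ allow V then (1:ℝ) else 0)) :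
    (tuples n P).card * ρ / (∏ u ∈ Finset.Icc 1 n, ((P u).factorial : ℝ)) ≤
      Ep n p (fun G => Xbar G P) := by
  have hp := prod_fact_pos n P
  calc _ ≤ (∑ V ∈ tuples n P, Ep n p (fun G => if G.edgeFinset ⊆ allow V then (1:ℝ) else 0)) /
        (∏ u ∈ Finset.Icc 1 n, ((P u).factorial : ℝ)) := by
        gcongr
        rw [← nsmul_eq_mul]
        exact Finset.card_nsmul_le_sum _ _ _ hρ
    _ = _ := (Ep_sum _ _).symm
    _ ≤ _ := Ep_mono h0 h1 fun G => by
        unfold Xbar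
        gcongr
        exact Xprofile_ge G P

lemma Em_Xbar_ge {n m : ℕ} {P : ℕ → ℕ} {ρ : ℝ}
    (hρ : ∀ V ∈ tuples n P, ρ ≤ Em n m (fun G => if G.edgeFinset ⊆ allow V then (1:ℝ) else 0)) :
    (tuples n P).card * ρ / (∏ u ∈ Finset.Icc 1 n, ((P u).factorial : ℝ)) ≤
      Em n m (fun G => Xbar G P) := by
  have hp := prod_fact_pos n P
  calc _ ≤ (∑ V ∈ tuples n P, Em n m (fun G => if G.edgeFinset ⊆ allow V then (1:ℝ) else 0)) /
        (∏ u ∈ Finset.Icc 1 n, ((P u).factorial : ℝ)) := by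
        gcongr
        rw [← nsmul_eq_mul]
        exact Finset.card_nsmul_le_sum _ _ _ hρ
    _ = _ := (Em_sum _ _).symm
    _ ≤ _ := Em_mono fun G => by
        unfold Xbar
        gcongr
        exact Xprofile_ge G P

lemma tuples_f {n : ℕ} {P : ℕ → ℕ} (hP : ∀ u, u ∉ Finset.Icc 1 n → P u = 0)
    {V} (hV : V ∈ tuples n P) :
    ∑ i, (V i).card.choose 2 = ∑ u ∈ Finset.Icc 1 n, P u * u.choose 2 := by
  rw [tuples, Finset.mem_filter] at hV
  exact tuples_sum hP (fun i => (V i).card) hV.2.2.2 (fun u => u.choose 2)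

lemma exp_neg_two_le {y : ℝ} (h0 : 0 ≤ y) (h1 : y ≤ 1/2) : Real.exp (-(2*y)) ≤ 1 - y := by
  rw [Real.exp_neg]
  have h := Real.add_one_le_exp (2*y)
  rw [inv_le_comm₀ (Real.exp_pos _) (by linarith)]
  refine le_trans ?_ h
  rw [inv_le_iff_one_le_mul₀ (by linarith)]
  nlinarith

lemma choose_ratio {N f m : ℕ} {p : ℝ} (hp0 : 0 < p) (hp1 : p < 1) (hm : (m:ℝ) ≤ p * N)
    (hN : 0 < N) (hf : 2 * f ≤ N) (hy : 2 * p / (1-p) * (f / N) ≤ 1/2) :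
    (1-p)^f * Real.exp (-(2 * (2 * p / (1-p)) * (f^2 / N))) * (N.choose m : ℝ) ≤
      ((N - f).choose m : ℝ) := by
  have hq : 0 < 1 - p := by linarith
  have hNr : (0:ℝ) < N := by exact_mod_cast hN
  have hfr : 2 * (f:ℝ) ≤ N := by exact_mod_cast hf
  set y := 2 * p / (1-p) * (f / N) with hydef
  have hy0 : 0 ≤ y := by positivity
  set r := (1-p) * Real.exp (-(2*y)) with hr
  have hr0 : 0 ≤ r := by positivity
  have hrle : r ≤ (1-p) * (1 - y) := by
    rw [hr]; gcongr; exact exp_neg_two_le hy0 hy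
  have hqy : (1-p) * y = 2 * p * (f / N) := by rw [hydef]; field_simp
  have key : ∀ j, j ≤ f → r^j * (N.choose m : ℝ) ≤ ((N - j).choose m : ℝ) := by
    intro j
    induction j with
    | zero => intro _; simp
    | succ j ih =>
      intro hj
      have ih := ih (by omega)
      obtain ⟨x, hx⟩ : ∃ x, N - j = x + 1 := ⟨N - j - 1, by omega⟩
      have hx' : N - (j+1) = x := by omega
      have hxN : (x:ℝ) + 1 = N - j := by
        have : x + 1 + j = N := by omega
        rw [← this]; push_cast; ring
      rw [hx] at ih
      rw [hx']
      have hc := Nat.choose_mul_succ_eq x m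
      have hcr : (x.choose m : ℝ) * (x + 1) = ((x+1).choose m : ℝ) * ((x + 1 - m : ℕ) : ℝ) := by
        exact_mod_cast hc
      have hsub : (x:ℝ) + 1 - m ≤ ((x + 1 - m : ℕ) : ℝ) := by
        have : x + 1 ≤ (x + 1 - m) + m := by omega
        have : (x:ℝ) + 1 ≤ ((x + 1 - m : ℕ) : ℝ) + m := by exact_mod_cast this
        linarith
      have hjf : (j:ℝ) ≤ f := by exact_mod_cast (by omega : j ≤ f)
      have hj0 : (0:ℝ) ≤ j := Nat.cast_nonneg _
      have hx1 : (0:ℝ) < (x:ℝ) + 1 := by positivity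
      have hmain : r * ((x:ℝ)+1) ≤ (x:ℝ) + 1 - m := by
        have h1 : r * ((x:ℝ)+1) ≤ ((1-p) * (1 - y)) * ((x:ℝ)+1) := by gcongr
        refine h1.trans ?_
        have h2 : ((1-p) * (1 - y)) * ((x:ℝ)+1) = (1-p) * (N - j) - 2 * p * (f / N) * (N - j) := by
          rw [hxN]; linear_combination (-(N - j : ℝ)) * hqy
        rw [h2, hxN]
        have h3 : (f:ℝ) ≤ 2 * (f / N) * (N - j) := by
          have : (1:ℝ)/2 ≤ (N - j) / N := by
            rw [le_div_iff₀ hNr]; linarith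
          have hf0 : (0:ℝ) ≤ f := Nat.cast_nonneg _
          calc (f:ℝ) = 2 * f * (1/2) := by ring
            _ ≤ 2 * f * ((N - j) / N) := by gcongr
            _ = _ := by ring
        nlinarith
      have h5 : r^(j+1) * (N.choose m : ℝ) * (x+1) ≤ (x.choose m : ℝ) * (x+1) := by
        calc r^(j+1) * (N.choose m : ℝ) * (x+1) = (r^j * (N.choose m : ℝ)) * (r * (x+1)) := by ring
          _ ≤ ((x+1).choose m : ℝ) * (r * (x+1)) := by gcongr
          _ ≤ ((x+1).choose m : ℝ) * ((x + 1 - m : ℕ) : ℝ) := by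
            gcongr; exact hmain.trans hsub
          _ = _ := hcr.symm
      exact le_of_mul_le_mul_right h5 hx1
  have := key f le_rfl
  rw [hr, mul_pow, ← Real.exp_nat_mul] at this
  have e : (f:ℝ) * -(2*y) = -(2 * (2 * p / (1-p)) * (f^2 / N)) := by rw [hydef]; ring
  rwa [e] at this

lemma log_fact_ge (n : ℕ) (hn : 0 < n) : n * Real.log n - n ≤ Real.log n.factorial := by
  have h := Real.pow_div_factorial_le_exp (n:ℝ) (Nat.cast_nonneg _) n
  have hf : (0:ℝ) < n.factorial := by exact_mod_cast Nat.factorial_pos n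
  have hn' : (0:ℝ) < n := by exact_mod_cast hn
  have h2 := Real.log_le_log (by positivity) h
  rw [Real.log_div (by positivity) (by positivity), Real.log_pow, Real.log_exp] at h2
  linarith

lemma log_fact_le (r : ℕ) :
    Real.log r.factorial ≤ r * Real.log r - r + Real.log r + 1 := by
  rcases Nat.eq_zero_or_pos r with rfl | hr
  · simp
  induction r, hr using Nat.le_induction with
  | base => simp
  | succ r hr ih =>
    have hr' : (0:ℝ) < r := by exact_mod_cast hr
    rw [Nat.factorial_succ]
    push_cast
    rw [Real.log_mul (by positivity) (by positivity)]
    have h := Real.log_le_sub_one_of_pos (show (0:ℝ) < r / (r+1) by positivity)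
    rw [Real.log_div (by positivity) (by positivity)] at h
    have h2 : (r:ℝ) / (r+1) - 1 = - (1 / (r+1)) := by field_simp; ring
    rw [h2] at h
    have h3 : ((r:ℝ)+1) * (Real.log r - Real.log (r+1)) ≤ -1 := by
      calc _ ≤ ((r:ℝ)+1) * -(1/(r+1)) := by gcongr
        _ = -1 := by field_simp
    nlinarith

lemma term_ineq {n u k : ℕ} {p ε δ : ℝ} (hp0 : 0 < p) (hp1 : p < 1) (hδ : 0 < δ) (hδε : δ < ε)
    (hn : 0 < n) (hk : 0 < k) (hkn : k ≤ n)
    (hu : (u:ℝ) ≤ 2 * Real.logb (1/(1-p)) n)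
    (hmu : (n : ℝ) ^ ((1:ℝ) + ε) ≤ muExp (1-p) n u) :
    k * Real.log u.factorial + Real.log k.factorial + k * (u.choose 2) * Real.log (1/(1-p)) +
      δ * (Real.log (1/(1-p)) / 2) * (u * k) ≤ u * k * Real.log n := by
  have hq : 0 < 1 - p := by linarith
  have hn' : (0:ℝ) < n := by exact_mod_cast hn
  have hk' : (0:ℝ) < k := by exact_mod_cast hk
  have hb : 1 < 1/(1-p) := by rw [lt_div_iff₀ hq]; linarith
  have hlb : 0 < Real.log (1/(1-p)) := Real.log_pos hb
  have hlq : Real.log (1-p) = - Real.log (1/(1-p)) := by rw [one_div, Real.log_inv, neg_neg]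
  have hfu : (0:ℝ) < u.factorial := by exact_mod_cast Nat.factorial_pos u
  set lb := Real.log (1/(1-p)) with hlbdef
  have hu' : u * lb ≤ 2 * Real.log n := by
    rw [Real.logb, ← mul_div_assoc, le_div_iff₀ hlb] at hu
    exact hu
  have h1 : (n : ℝ) ^ ((1:ℝ) + ε) ≤ (n:ℝ)^u / u.factorial * (1-p)^(u.choose 2) := by
    refine hmu.trans ?_
    unfold muExp
    gcongr
    exact Nat.choose_le_pow_div u n
  have h2 := Real.log_le_log (by positivity) h1
  rw [Real.log_rpow hn', Real.log_mul (by positivity) (by positivity),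
    Real.log_div (by positivity) (by positivity), Real.log_pow, Real.log_pow, hlq] at h2
  have h3 : Real.log k.factorial ≤ k * Real.log n := by
    have : (k.factorial : ℝ) ≤ (k:ℝ)^k := by exact_mod_cast Nat.factorial_le_pow k
    have h4 := Real.log_le_log (by exact_mod_cast Nat.factorial_pos k) this
    rw [Real.log_pow] at h4
    refine h4.trans ?_
    gcongr
  have hln : 0 ≤ Real.log n := Real.log_natCast_nonneg n
  have h5 : δ * (lb / 2) * u ≤ ε * Real.log n := by
    have : δ * (u * lb) ≤ δ * (2 * Real.log n) := by gcongr
    have : δ * Real.log n ≤ ε * Real.log n := by gcongr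
    linarith
  have h6 : k * (Real.log u.factorial + (u.choose 2) * lb + δ * (lb/2) * u) ≤
      k * (u * Real.log n - Real.log n) := by
    apply mul_le_mul_of_nonneg_left _ hk'.le
    linarith
  nlinarith

lemma det {n M f : ℕ} {P : ℕ → ℕ} {p ε δ η : ℝ} (hp0 : 0 < p) (hp1 : p < 1) (hδ : 0 < δ)
    (hδε : δ < ε) (hn : 0 < n)
    (hs : ∑ u ∈ Finset.Icc 1 n, u * P u ≤ n)
    (hf : f = ∑ u ∈ Finset.Icc 1 n, P u * u.choose 2)
    (hM : n.factorial ≤ M * (∏ u ∈ Finset.Icc 1 n, u.factorial ^ P u) *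
      (n - ∑ u ∈ Finset.Icc 1 n, u * P u).factorial)
    (hu : ∀ u, P u ≠ 0 → (u:ℝ) ≤ 2 * Real.logb (1/(1-p)) n ∧
      (n : ℝ) ^ ((1:ℝ) + ε) ≤ muExp (1-p) n u) :
    Real.exp (phiTilde p δ (kappaTot n P) * n - (Real.log n + 1 + η)) ≤
      M * ((1-p)^f * Real.exp (-η)) / (∏ u ∈ Finset.Icc 1 n, ((P u).factorial : ℝ)) := by
  have hq : 0 < 1 - p := by linarith
  have hn' : (0:ℝ) < n := by exact_mod_cast hn
  have hlq : Real.log (1-p) = - Real.log (1/(1-p)) := by rw [one_div, Real.log_inv, neg_neg]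
  set s := ∑ u ∈ Finset.Icc 1 n, u * P u with hsdef
  obtain ⟨R, hR⟩ : ∃ R, n = s + R := ⟨n - s, by omega⟩
  have hRs : n - s = R := by omega
  rw [hRs] at hM
  have hRr : (n:ℝ) = s + R := by exact_mod_cast hR
  have hB := prod_fact_pos n P
  have hA : (0:ℝ) < ∏ u ∈ Finset.Icc 1 n, (u.factorial : ℝ) ^ P u :=
    Finset.prod_pos fun u _ => pow_pos (by exact_mod_cast Nat.factorial_pos _) _
  have hRf : (0:ℝ) < R.factorial := by exact_mod_cast Nat.factorial_pos R
  have hnf : (0:ℝ) < n.factorial := by exact_mod_cast Nat.factorial_pos n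
  have hMr : (n.factorial : ℝ) / ((∏ u ∈ Finset.Icc 1 n, (u.factorial : ℝ) ^ P u) * R.factorial)
      ≤ M := by
    rw [div_le_iff₀ (by positivity), ← mul_assoc]
    exact_mod_cast hM
  refine le_trans ?_ (show (n.factorial : ℝ) /
    ((∏ u ∈ Finset.Icc 1 n, (u.factorial : ℝ) ^ P u) * R.factorial) *
    ((1-p)^f * Real.exp (-η)) / (∏ u ∈ Finset.Icc 1 n, ((P u).factorial : ℝ)) ≤ _ by gcongr)
  rw [← Real.le_log_iff_exp_le (by positivity)]
  rw [Real.log_div (by positivity) hB.ne', Real.log_mul (by positivity) (by positivity),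
    Real.log_div (by positivity) (by positivity), Real.log_mul hA.ne' (by positivity),
    Real.log_mul (by positivity) (by positivity), Real.log_exp, Real.log_pow, hlq,
    Real.log_prod (fun u _ => by positivity), Real.log_prod (fun u _ => by positivity)]
  have hterm : ∑ u ∈ Finset.Icc 1 n, (P u * Real.log u.factorial + Real.log (P u).factorial +
      P u * (u.choose 2) * Real.log (1/(1-p)) + δ * (Real.log (1/(1-p)) / 2) * (u * P u)) ≤
      ∑ u ∈ Finset.Icc 1 n, u * P u * Real.log n := by
    refine Finset.sum_le_sum fun u hu' => ?_
    by_cases h : P u = 0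
    · simp [h]
    · refine term_ineq hp0 hp1 hδ hδε hn (Nat.pos_of_ne_zero h) ?_ (hu u h).1 (hu u h).2
      have h1 : u * P u ≤ s := Finset.single_le_sum (f := fun u => u * P u)
        (fun _ _ => Nat.zero_le _) hu'
      have h2 : P u ≤ u * P u := Nat.le_mul_of_pos_left _ (Finset.mem_Icc.1 hu').1
      omega
  rw [Finset.sum_add_distrib, Finset.sum_add_distrib, Finset.sum_add_distrib, ← Finset.sum_mul,
    ← Finset.mul_sum, ← Finset.sum_mul] at hterm
  have hsr : ∑ u ∈ Finset.Icc 1 n, (u:ℝ) * P u = s := by rw [hsdef]; push_cast; rfl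
  have hfr : ∑ u ∈ Finset.Icc 1 n, (P u:ℝ) * (u.choose 2) = f := by rw [hf]; push_cast; rfl
  rw [hsr, hfr] at hterm
  have hpow : ∑ u ∈ Finset.Icc 1 n, Real.log ((u.factorial:ℝ) ^ P u) =
      ∑ u ∈ Finset.Icc 1 n, P u * Real.log u.factorial :=
    Finset.sum_congr rfl fun u _ => Real.log_pow _ _
  rw [hpow]
  have hk : kappaTot n P = s / n := by
    rw [kappaTot, ← Finset.sum_div, hsr]
  have h1k : 1 - (s:ℝ)/n = R / n := by
    rw [eq_div_iff hn'.ne', sub_mul, div_mul_cancel₀ _ hn'.ne']; linarith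
  have hlogR : (R:ℝ) * Real.log (R/n) = R * (Real.log R - Real.log n) := by
    rcases Nat.eq_zero_or_pos R with h | h
    · simp [h]
    · have : (0:ℝ) < R := by exact_mod_cast h
      rw [Real.log_div (by positivity) (by positivity)]
  have hphi : phiTilde p δ (kappaTot n P) * n = - (R * (Real.log R - Real.log n)) -
      (1 - Real.log (1/(1-p)) / 2 * δ) * s := by
    rw [hk, phiTilde, h1k, ← hlogR]
    field_simp
  rw [hphi]
  have hst1 := log_fact_ge n hn
  have hst2 := log_fact_le R
  have hRn : Real.log R ≤ Real.log n := by
    rcases Nat.eq_zero_or_pos R with h | h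
    · simp [h, Real.log_natCast_nonneg n]
    · have : (0:ℝ) < R := by exact_mod_cast h
      exact Real.log_le_log this (by exact_mod_cast (by omega : R ≤ n))
  have hnn : n * Real.log n = s * Real.log n + R * Real.log n := by
    linear_combination Real.log n * hRr
  nlinarith

lemma mu_mono {n : ℕ} {p : ℝ} (hp0 : 0 < p) (hp1 : p < 1) (hn : 0 < n) {u a : ℕ}
    (hu : Real.logb (1/(1-p)) n ≤ u) (hua : u ≤ a) : muExp (1-p) n a ≤ muExp (1-p) n u := by
  have hq : 0 < 1 - p := by linarith
  have hn' : (0:ℝ) < n := by exact_mod_cast hn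
  have hb : 1 < 1/(1-p) := by rw [lt_div_iff₀ hq]; linarith
  induction a, hua using Nat.le_induction with
  | base => exact le_rfl
  | succ v hv ih =>
    refine le_trans ?_ ih
    have hnv : (n:ℝ) * (1-p)^v ≤ 1 := by
      have h1 : Real.logb (1/(1-p)) n ≤ v := hu.trans (by exact_mod_cast hv)
      rw [Real.logb_le_iff_le_rpow hb hn', Real.rpow_natCast, one_div, inv_pow] at h1
      calc (n:ℝ) * (1-p)^v ≤ ((1-p)^v)⁻¹ * (1-p)^v := by gcongr
        _ = 1 := inv_mul_cancel₀ (by positivity)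
    have hc : n.choose (v+1) ≤ n.choose v * n := by
      calc n.choose (v+1) ≤ n.choose (v+1) * (v+1) := Nat.le_mul_of_pos_right _ (by omega)
        _ = n.choose v * (n - v) := Nat.choose_succ_right_eq n v
        _ ≤ _ := by gcongr; omega
    have hcr : (n.choose (v+1) : ℝ) ≤ n.choose v * n := by exact_mod_cast hc
    unfold muExp
    rw [Nat.choose_succ_succ' v 1, Nat.choose_one_right, pow_add]
    calc (n.choose (v+1) : ℝ) * ((1-p)^v * (1-p)^(v.choose 2))
        ≤ (n.choose v * n) * ((1-p)^v * (1-p)^(v.choose 2)) := by gcongr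
      _ = n.choose v * (1-p)^(v.choose 2) * (n * (1-p)^v) := by ring
      _ ≤ n.choose v * (1-p)^(v.choose 2) * 1 := by gcongr
      _ = _ := by ring

lemma f_bound {n f : ℕ} {P : ℕ → ℕ} {L : ℝ} (hL : 0 ≤ L)
    (hs : ∑ u ∈ Finset.Icc 1 n, u * P u ≤ n)
    (hf : f = ∑ u ∈ Finset.Icc 1 n, P u * u.choose 2)
    (hu : ∀ u, P u ≠ 0 → (u:ℝ) ≤ 2 * L) : (f:ℝ) ≤ n * L := by
  have h1 : (f:ℝ) ≤ ∑ u ∈ Finset.Icc 1 n, ((u:ℝ) * P u) * L := by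
    rw [hf]
    push_cast
    refine Finset.sum_le_sum fun u _ => ?_
    by_cases h : P u = 0
    · simp [h]
    · have h2 := hu u h
      rw [Nat.cast_choose_two]
      have h3 : (u:ℝ) * ((u - 1) / 2) ≤ u * L := by gcongr; linarith
      have h4 : (0:ℝ) ≤ P u := Nat.cast_nonneg _
      nlinarith
  rw [← Finset.sum_mul] at h1
  refine h1.trans ?_
  gcongr
  exact_mod_cast hs

/-- The eventual (in `n`) facts. -/
lemma eventual_facts (p : ℝ) (hp0 : 0 < p) (hp1 : p < 1)
    (a : ℕ → ℕ)
    (ha : ∃ C : ℝ, ∀ᶠ n : ℕ in atTop, |alpha0 (1/(1-p)) n - (a n : ℝ)| ≤ C)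
    (ustar : ℕ → ℕ)
    (hustar : Tendsto (fun n : ℕ => (ustar n : ℝ) / (2 * Real.logb (1/(1-p)) n))
      atTop (nhds 1)) :
    ∀ᶠ n : ℕ in atTop, 2 ≤ n ∧ 1 ≤ Real.log n ∧ 0 < Real.logb (1/(1-p)) n ∧
      Real.logb (1/(1-p)) n ≤ ustar n ∧ (a n : ℝ) ≤ 2 * Real.logb (1/(1-p)) n ∧
      (1 + 2 * p / (1-p)) * (4 * Real.logb (1/(1-p)) n / n) ≤ 1/2 := by
  have hq : 0 < 1 - p := by linarith
  have hb : 1 < 1/(1-p) := by rw [lt_div_iff₀ hq]; linarith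
  have hlb : 0 < Real.log (1/(1-p)) := Real.log_pos hb
  have hLb : Tendsto (fun n : ℕ => Real.logb (1/(1-p)) n) atTop atTop :=
    (Real.tendsto_logb_atTop hb).comp tendsto_natCast_atTop_atTop
  have hLLb : Tendsto (fun n : ℕ => Real.logb (1/(1-p)) (Real.logb (1/(1-p)) n)) atTop atTop :=
    (Real.tendsto_logb_atTop hb).comp hLb
  obtain ⟨C, hC⟩ := ha
  have hlog : Tendsto (fun n : ℕ => Real.log n) atTop atTop :=
    Real.tendsto_log_atTop.comp tendsto_natCast_atTop_atTop
  have hdiv : Tendsto (fun n : ℕ => Real.log n / n) atTop (nhds 0) := by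
    have := (Real.tendsto_pow_log_div_mul_add_atTop 1 0 1 one_ne_zero).comp
      (tendsto_natCast_atTop_atTop (R := ℝ))
    refine this.congr fun n => ?_
    simp
  have hdiv2 : Tendsto (fun n : ℕ => (1 + 2 * p / (1-p)) * (4 * Real.logb (1/(1-p)) n / n))
      atTop (nhds 0) := by
    have := hdiv.const_mul ((1 + 2 * p / (1-p)) * 4 / Real.log (1/(1-p)))
    rw [mul_zero] at this
    refine this.congr fun n => ?_
    rw [Real.logb]
    ring
  filter_upwards [eventually_ge_atTop 2, hlog.eventually_ge_atTop 1, hLb.eventually_gt_atTop 0,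
    hustar.eventually (lt_mem_nhds (show (1/2:ℝ) < 1 by norm_num)), hC,
    hLLb.eventually_ge_atTop ((2 * Real.logb (1/(1-p)) (Real.exp 1 / 2) + 1 + C)/2),
    hdiv2.eventually (gt_mem_nhds (show (0:ℝ) < 1/2 by norm_num))] with n h1 h2 h3 h4 h5 h6 h7
  refine ⟨h1, h2, h3, ?_, ?_, h7.le⟩
  · rw [lt_div_iff₀ (by positivity)] at h4
    linarith
  · have := (abs_le.1 h5).1
    rw [alpha0] at this
    linarith

end ELB

/-- Lemma 3.5: a uniform lower bound `exp(φ̃_δ(κ) n + O(ln² n))` for the expected number of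
unordered colourings of `a`-bounded profiles with all classes of size at least `u*`. -/
theorem expectation_lower_bound (p ε δ : ℝ) (hp : p ∈ Set.Ioo (0:ℝ) 1)
    (hδ : 0 < δ) (hδε : δ < ε)
    (a : ℕ → ℕ)
    (ha : ∃ C : ℝ, ∀ᶠ n : ℕ in atTop, |alpha0 (1/(1-p)) n - (a n : ℝ)| ≤ C)
    (hmu : ∀ᶠ n : ℕ in atTop, (n : ℝ) ^ ((1:ℝ) + ε) ≤ muExp (1-p) n (a n))
    (ustar : ℕ → ℕ)
    (hustar : Tendsto (fun n : ℕ => (ustar n : ℝ) / (2 * Real.logb (1/(1-p)) n))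
      atTop (nhds 1)) :
    ∃ C : ℝ, 0 < C ∧ ∀ᶠ n : ℕ in atTop, ∀ P : ℕ → ℕ,
      IsProfile n (profileParts n P) P → IsBoundedProfile (a n) P →
      (∀ u, u < ustar n → P u = 0) →
      Real.exp (phiTilde p δ (kappaTot n P) * n - C * (Real.log n) ^ 2) ≤
          Em n (mFloor p n) (fun G => Xbar G P) ∧
      Real.exp (phiTilde p δ (kappaTot n P) * n - C * (Real.log n) ^ 2) ≤
          Ep n p (fun G => Xbar G P) := by
  obtain ⟨hp0, hp1⟩ := hp
  have hq : 0 < 1 - p := by linarith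
  have hb : 1 < 1/(1-p) := by rw [lt_div_iff₀ hq]; linarith
  have hlb : 0 < Real.log (1/(1-p)) := Real.log_pos hb
  set c := 2 * p / (1-p) with hc
  have hc0 : 0 < c := by positivity
  refine ⟨8 * c / (Real.log (1/(1-p)))^2 + 2, by positivity, ?_⟩
  filter_upwards [ELB.eventual_facts p hp0 hp1 a ha ustar hustar, hmu] with
    n ⟨hn2, hlog, hL0, hus, haL, hsmall⟩ hmun P hprof hbd hlow
  obtain ⟨hP, -, hs⟩ := hprof
  have hn : 0 < n := by omega
  have hn' : (0:ℝ) < n := by exact_mod_cast hn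
  have hn2' : (2:ℝ) ≤ n := by exact_mod_cast hn2
  set L := Real.logb (1/(1-p)) n with hL
  have hu : ∀ u, P u ≠ 0 → (u:ℝ) ≤ 2 * L ∧ (n : ℝ) ^ ((1:ℝ) + ε) ≤ muExp (1-p) n u := by
    intro u hu
    have h1 : u ≤ a n := by
      by_contra h
      exact hu (hbd u (by omega))
    have h2 : ustar n ≤ u := by
      by_contra h
      exact hu (hlow u (by omega))
    have h1' : (u:ℝ) ≤ a n := by exact_mod_cast h1
    have h2' : (ustar n:ℝ) ≤ u := by exact_mod_cast h2
    exact ⟨h1'.trans haL, hmun.trans (ELB.mu_mono hp0 hp1 hn (hus.trans h2') h1)⟩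
  obtain ⟨f, hf⟩ : ∃ f, f = ∑ u ∈ Finset.Icc 1 n, P u * u.choose 2 := ⟨_, rfl⟩
  have hfL : (f:ℝ) ≤ n * L := ELB.f_bound hL0.le hs hf fun u h => (hu u h).1
  obtain ⟨N, hN⟩ : ∃ N, N = n.choose 2 := ⟨_, rfl⟩
  have hNr : (N:ℝ) = n * (n - 1) / 2 := by rw [hN, Nat.cast_choose_two]
  have hN4 : (n:ℝ)^2 / 4 ≤ N := by rw [hNr]; nlinarith
  have hNpos : (0:ℝ) < N := lt_of_lt_of_le (by positivity) hN4
  have hfN : (f:ℝ) / N ≤ 4 * L / n := by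
    calc (f:ℝ) / N ≤ (n * L) / ((n:ℝ)^2 / 4) := by gcongr
      _ = 4 * L / n := by field_simp
  have hf0 : (0:ℝ) ≤ f / N := by positivity
  have hx0 : 0 ≤ 4 * L / n := by positivity
  have hcx : 0 ≤ c * (4 * L / n) := by positivity
  have hcf : c * ((f:ℝ) / N) ≤ c * (4 * L / n) := by gcongr
  have h2f : 2 * f ≤ N := by
    have : (f:ℝ) / N ≤ 1/2 := by linarith
    rw [div_le_iff₀ hNpos] at this
    have : 2 * (f:ℝ) ≤ N := by linarith
    exact_mod_cast this
  have hcf2 : c * ((f:ℝ) / N) ≤ 1/2 := by linarith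
  obtain ⟨η, hη⟩ : ∃ η, η = 2 * c * ((f:ℝ)^2 / N) := ⟨_, rfl⟩
  have hη0 : 0 ≤ η := by rw [hη]; positivity
  have hηle : η ≤ 8 * c / (Real.log (1/(1-p)))^2 * (Real.log n)^2 := by
    calc η = 2 * c * (f * (f / N)) := by rw [hη]; ring
      _ ≤ 2 * c * ((n * L) * (4 * L / n)) := by gcongr
      _ = 8 * c * L^2 := by field_simp; ring
      _ = _ := by rw [hL, Real.logb, div_pow]; ring
  have hdet := ELB.det (η := η) hp0 hp1 hδ hδε hn hs hf (ELB.card_tuples hP hs) hu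
  have hexp : Real.exp (phiTilde p δ (kappaTot n P) * n -
      (8 * c / (Real.log (1/(1-p)))^2 + 2) * (Real.log n) ^ 2) ≤
      Real.exp (phiTilde p δ (kappaTot n P) * n - (Real.log n + 1 + η)) := by
    rw [Real.exp_le_exp]
    nlinarith
  have hm : ((mFloor p n : ℕ) : ℝ) ≤ p * N := by
    rw [mFloor, hN]
    exact Nat.floor_le (by positivity)
  have hmN : mFloor p n ≤ N := by
    have : ((mFloor p n : ℕ) : ℝ) ≤ N := hm.trans (by nlinarith)
    exact_mod_cast this
  have hratio := ELB.choose_ratio hp0 hp1 hm (by exact_mod_cast hNpos) h2f hcf2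
  rw [← hc, ← hη] at hratio
  refine ⟨hexp.trans (hdet.trans (ELB.Em_Xbar_ge fun V hV => ?_)),
    hexp.trans (hdet.trans (ELB.Ep_Xbar_ge hp0.le hp1.le fun V hV => ?_))⟩
  · rw [ELB.Em_ind, ← hN]
    have hpos : (0:ℝ) < N.choose (mFloor p n) := by exact_mod_cast Nat.choose_pos hmN
    rw [le_div_iff₀ hpos]
    refine hratio.trans ?_
    have h1 := ELB.card_allow V
    rw [ELB.tuples_f hP hV, ← hf, ← hN] at h1
    exact_mod_cast Nat.choose_le_choose _ h1
  · rw [ELB.Ep_ind, ← hN]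
    have h1 := ELB.card_allow V
    rw [ELB.tuples_f hP hV, ← hf, ← hN] at h1
    calc (1-p)^f * Real.exp (-η) ≤ (1-p)^f * 1 := by
          gcongr
          rw [Real.exp_le_one_iff]; linarith
      _ = (1-p)^f := mul_one _
      _ ≤ _ := pow_le_pow_of_le_one hq.le (by linarith) (by omega)
end
end

section
/- Let p ∈ (0,1) be constant and let m = m(n) satisfy m = N·p + O(1), where N = C(n,2). If x = x(n) = o(n^{4/3}), then C(N−x, m)/C(N, m) ~ q^x · exp(−(b−1)·x^2/n^2) as n → ∞, where q = 1−p and b = 1/q. -/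
open Filter
open scoped BigOperators

lemma aux_prod (N m : ℕ) : ∀ x : ℕ, m + x ≤ N →
    ((N - x).choose m : ℝ) / (N.choose m : ℝ)
      = ∏ i ∈ Finset.range x, ((N : ℝ) - m - i) / ((N : ℝ) - i) := by
  intro x
  induction x with
  | zero =>
    intro h
    have : (N.choose m : ℝ) ≠ 0 := by
      exact_mod_cast (Nat.choose_pos (by omega)).ne'
    simp [this]
  | succ x ih =>
    intro h
    rw [Finset.prod_range_succ, ← ih (by omega)]
    have h0 : (N.choose m : ℝ) ≠ 0 := by
      exact_mod_cast (Nat.choose_pos (by omega)).ne'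
    obtain ⟨k, rfl⟩ : ∃ k, N = m + (x + 1) + k := ⟨N - (m + (x+1)), by omega⟩
    have e1 : m + (x + 1) + k - x = m + k + 1 := by omega
    have e2 : m + (x + 1) + k - (x + 1) = m + k := by omega
    rw [e1, e2]
    have key := Nat.choose_mul_succ_eq (m + k) m
    have e3 : m + k + 1 - m = k + 1 := by omega
    rw [e3] at key
    have key' : ((m + k).choose m : ℝ) * ((m : ℝ) + k + 1)
        = ((m + k + 1).choose m : ℝ) * ((k : ℝ) + 1) := by exact_mod_cast key
    have e4 : (((m + (x + 1) + k : ℕ) : ℝ) - m - x) = (k : ℝ) + 1 := by push_cast; ring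
    have e5 : (((m + (x + 1) + k : ℕ) : ℝ) - x) = (m : ℝ) + k + 1 := by push_cast; ring
    rw [e4, e5]
    have h5 : (m : ℝ) + k + 1 ≠ 0 := by positivity
    rw [div_mul_div_comm, ← key']
    field_simp

lemma aux_log (t : ℝ) (h : |t| ≤ 1 / 2) : |Real.log (1 - t) + t| ≤ 2 * t ^ 2 := by
  obtain ⟨h1, h2⟩ := abs_le.1 h
  have hp : 0 < 1 - t := by linarith
  have u := Real.log_le_sub_one_of_pos hp
  have l := Real.one_sub_inv_le_log_of_pos hp
  have e : 1 - (1 - t)⁻¹ = -t - t ^ 2 / (1 - t) := by field_simp; ring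
  have e2 : t ^ 2 / (1 - t) ≤ 2 * t ^ 2 := by
    rw [div_le_iff₀ hp]; nlinarith [sq_nonneg t]
  rw [abs_le]
  constructor <;> nlinarith [sq_nonneg t]

set_option maxHeartbeats 2000000 in
lemma aux_factor (p C N m i X : ℝ) (hp0 : 0 < p) (hp1 : p < 1) (hC : 0 ≤ C)
    (hm : |m - N * p| ≤ C) (hi : 0 ≤ i) (hiX : i ≤ X) (hN : 1 ≤ N) (hX : 2 * X ≤ N)
    (hs : 4 * (C + X) ≤ (1 - p) * N) :
    0 < (N - m - i) / (N - i) ∧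
    |Real.log ((N - m - i) / (N - i)) - Real.log (1 - p) + p / (1 - p) * (i / N)|
      ≤ ((2 / (1 - p)) * (C + 1) + 16 / (1 - p) ^ 2 * (C ^ 2 + 1)) * (1 / N + X ^ 2 / N ^ 2) := by
  set q := 1 - p with hq
  have hq0 : 0 < q := by rw [hq]; linarith
  have hN0 : 0 < N := by linarith
  have hNi : N / 2 ≤ N - i := by linarith
  have hNi0 : 0 < N - i := by linarith
  have hX0 : 0 ≤ X := hi.trans hiX
  set d := m - N * p with hd
  set t := (d + i * p) / (q * (N - i)) with ht
  have hnum : |d + i * p| ≤ C + X := by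
    refine (abs_add_le _ _).trans (add_le_add hm ?_)
    rw [abs_of_nonneg (by positivity)]
    nlinarith
  have hden : q * N / 2 ≤ q * (N - i) := by nlinarith
  have hqN : 0 < q * N := by positivity
  have htabs : |t| ≤ 2 * (C + X) / (q * N) := by
    rw [ht, abs_div, abs_of_pos (show 0 < q * (N - i) by positivity)]
    rw [div_le_div_iff₀ (by positivity) hqN]
    nlinarith [abs_nonneg (d + i * p)]
  have hthalf : |t| ≤ 1 / 2 := by
    refine htabs.trans ?_
    rw [div_le_iff₀ hqN]; linarith
  have hfac : (N - m - i) / (N - i) = q * (1 - t) := by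
    rw [ht, hd]; field_simp; rw [hq]; ring
  have h1t : 0 < 1 - t := by linarith [(abs_le.1 hthalf).2]
  rw [hfac]
  refine ⟨by positivity, ?_⟩
  rw [Real.log_mul hq0.ne' h1t.ne']
  have e : Real.log q + Real.log (1 - t) - Real.log q + p / q * (i / N)
      = (Real.log (1 - t) + t) - (t - p / q * (i / N)) := by ring
  rw [e]
  have hdiff : t - p / q * (i / N) = (d * N + p * i ^ 2) / (q * N * (N - i)) := by
    rw [ht]; field_simp; ring
  have hnum2 : |d * N + p * i ^ 2| ≤ C * N + X ^ 2 := by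
    refine (abs_add_le _ _).trans (add_le_add ?_ ?_)
    · rw [abs_mul, abs_of_pos hN0]; gcongr
    · rw [abs_of_nonneg (by positivity)]
      have : i ^ 2 ≤ X ^ 2 := by gcongr
      nlinarith [sq_nonneg i]
  have hd1 : |t - p / q * (i / N)| ≤ 2 / q * (C / N + X ^ 2 / N ^ 2) := by
    rw [hdiff, abs_div, abs_of_pos (show 0 < q * N * (N - i) by positivity)]
    have : 2 / q * (C / N + X ^ 2 / N ^ 2) = (C * N + X ^ 2) / (q * N * (N / 2)) := by
      field_simp
    rw [this]
    gcongr
  have ht2 : t ^ 2 ≤ 8 / q ^ 2 * (C ^ 2 / N ^ 2 + X ^ 2 / N ^ 2) := by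
    rw [← sq_abs]
    calc |t| ^ 2 ≤ (2 * (C + X) / (q * N)) ^ 2 := by gcongr
      _ = 4 / (q ^ 2 * N ^ 2) * (C + X) ^ 2 := by field_simp; ring
      _ ≤ 4 / (q ^ 2 * N ^ 2) * (2 * (C ^ 2 + X ^ 2)) := by
        gcongr; nlinarith [sq_nonneg (C - X)]
      _ = _ := by field_simp; ring
  have hinv : 1 / N ^ 2 ≤ 1 / N := by
    apply one_div_le_one_div_of_le hN0; nlinarith
  have a0 : 0 ≤ 1 / N := by positivity
  have b0 : 0 ≤ X ^ 2 / N ^ 2 := by positivity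
  calc _ ≤ |Real.log (1 - t) + t| + |t - p / q * (i / N)| := abs_sub _ _
    _ ≤ 2 * (8 / q ^ 2 * (C ^ 2 / N ^ 2 + X ^ 2 / N ^ 2)) + 2 / q * (C / N + X ^ 2 / N ^ 2) := by
      have := aux_log t hthalf
      linarith
    _ = 16 / q ^ 2 * (C ^ 2 * (1 / N ^ 2) + X ^ 2 / N ^ 2)
          + 2 / q * (C * (1 / N) + X ^ 2 / N ^ 2) := by ring
    _ ≤ 16 / q ^ 2 * ((C ^ 2 + 1) * (1 / N + X ^ 2 / N ^ 2))
          + 2 / q * ((C + 1) * (1 / N + X ^ 2 / N ^ 2)) := by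
      have c2 : 0 ≤ C ^ 2 := sq_nonneg C
      gcongr
      · have h1 := mul_le_mul_of_nonneg_left hinv c2
        have h2 := mul_nonneg c2 b0
        rw [add_mul, mul_add]
        linarith
      · have h2 := mul_nonneg hC b0
        rw [add_mul, mul_add]
        linarith
    _ = _ := by ring

lemma aux_main (p C : ℝ) (N m x : ℕ) (hp0 : 0 < p) (hp1 : p < 1) (hC : 0 ≤ C)
    (hm : |(m : ℝ) - N * p| ≤ C) (hN : 1 ≤ N) (hX : 2 * (x : ℝ) ≤ N)
    (hs : 4 * (C + x) ≤ (1 - p) * N) :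
    0 < ((N - x).choose m : ℝ) / (N.choose m : ℝ) ∧
    |Real.log (((N - x).choose m : ℝ) / (N.choose m : ℝ)) - x * Real.log (1 - p)
        + p / (1 - p) * ((x : ℝ) * (x - 1) / (2 * N))|
      ≤ ((2 / (1 - p)) * (C + 1) + 16 / (1 - p) ^ 2 * (C ^ 2 + 1)) *
        ((x : ℝ) / N + (x : ℝ) ^ 3 / (N : ℝ) ^ 2) := by
  have hN' : (1 : ℝ) ≤ N := by exact_mod_cast hN
  have hle : m + x ≤ N := by
    have h1 := (abs_le.1 hm).2
    have hx0 : (0 : ℝ) ≤ x := by positivity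
    have : (m : ℝ) + x ≤ N := by nlinarith
    exact_mod_cast this
  rw [aux_prod N m x hle]
  have hf : ∀ i ∈ Finset.range x, _ := fun i hi =>
    aux_factor p C N m i x hp0 hp1 hC hm (by positivity)
      (by exact_mod_cast (Finset.mem_range.1 hi).le) hN' hX hs
  refine ⟨Finset.prod_pos fun i hi => (hf i hi).1, ?_⟩
  rw [Real.log_prod (fun i hi => (hf i hi).1.ne')]
  have hsum : ∑ i ∈ Finset.range x, (p / (1 - p) * ((i : ℝ) / N))
      = p / (1 - p) * ((x : ℝ) * (x - 1) / (2 * N)) := by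
    have : ∀ y : ℕ, ∑ i ∈ Finset.range y, (i : ℝ) = (y : ℝ) * (y - 1) / 2 := by
      intro y
      induction y with
      | zero => simp
      | succ y ih => rw [Finset.sum_range_succ, ih]; push_cast; ring
    rw [← Finset.mul_sum, ← Finset.sum_div, this, div_div]
  have hc : (x : ℝ) * Real.log (1 - p) = ∑ i ∈ Finset.range x, Real.log (1 - p) := by simp
  rw [← hsum, hc, ← Finset.sum_sub_distrib, ← Finset.sum_add_distrib]
  refine (Finset.abs_sum_le_sum_abs _ _).trans ?_
  refine (Finset.sum_le_sum fun i hi => (hf i hi).2).trans ?_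
  rw [Finset.sum_const, Finset.card_range, nsmul_eq_mul]
  apply le_of_eq
  ring

lemma aux_limits (x : ℕ → ℕ)
    (hx : (fun n : ℕ => (x n : ℝ)) =o[atTop] fun n : ℕ => (n : ℝ) ^ ((4:ℝ)/3)) :
    Tendsto (fun n : ℕ => (x n : ℝ) / (n : ℝ) ^ 2) atTop (nhds 0) ∧
    Tendsto (fun n : ℕ => (x n : ℝ) ^ 3 / (n : ℝ) ^ 4) atTop (nhds 0) ∧
    Tendsto (fun n : ℕ => (x n : ℝ) ^ 2 / (n : ℝ) ^ 3) atTop (nhds 0) := by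
  have hbig : ∀ (a : ℝ) (k : ℕ), a ≤ k →
      (fun n : ℕ => (n : ℝ) ^ a) =O[atTop] fun n : ℕ => (n : ℝ) ^ k := by
    intro a k hak
    apply Asymptotics.IsBigO.of_bound 1
    filter_upwards [eventually_ge_atTop 1] with n hn
    have hn' : (1 : ℝ) ≤ n := by exact_mod_cast hn
    rw [one_mul, Real.norm_of_nonneg (by positivity), Real.norm_of_nonneg (by positivity),
      ← Real.rpow_natCast]
    exact Real.rpow_le_rpow_of_exponent_le hn' hak
  have hpow : ∀ (j : ℕ), (fun n : ℕ => ((n : ℝ) ^ ((4:ℝ)/3)) ^ j)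
      = fun n : ℕ => (n : ℝ) ^ ((4:ℝ)/3 * j) := by
    intro j; funext n
    rw [Real.rpow_mul (by positivity), Real.rpow_natCast]
  refine ⟨?_, ?_, ?_⟩
  · exact (hx.trans_isBigO (hbig _ 2 (by norm_num))).tendsto_div_nhds_zero
  · have := hx.pow (n := 3) (by norm_num)
    rw [hpow] at this
    exact (this.trans_isBigO (hbig _ 4 (by norm_num))).tendsto_div_nhds_zero
  · have := hx.pow (n := 2) (by norm_num)
    rw [hpow] at this
    exact (this.trans_isBigO (hbig _ 3 (by norm_num))).tendsto_div_nhds_zero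

/-- Lemma 3.7: for constant `p ∈ (0,1)`, `m = Np + O(1)` and `x = o(n^{4/3})`,
`C(N−x, m)/C(N, m) ~ q^x exp(−(b−1)x²/n²)`. -/
theorem gnm_forbidden_edges_ratio (p : ℝ) (hp : p ∈ Set.Ioo (0:ℝ) 1)
    (m x : ℕ → ℕ)
    (hm : ∃ C : ℝ, ∀ᶠ n : ℕ in atTop, |(m n : ℝ) - (n.choose 2 : ℝ) * p| ≤ C)
    (hx : (fun n : ℕ => (x n : ℝ)) =o[atTop] fun n : ℕ => (n : ℝ) ^ ((4:ℝ)/3)) :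
    Asymptotics.IsEquivalent atTop
      (fun n : ℕ => ((n.choose 2 - x n).choose (m n) : ℝ) / ((n.choose 2).choose (m n) : ℝ))
      (fun n : ℕ => (1 - p) ^ x n *
        Real.exp (-(1/(1-p) - 1) * (x n : ℝ) ^ 2 / (n : ℝ) ^ 2)) := by
  obtain ⟨hp0, hp1⟩ := hp
  have hq0 : 0 < 1 - p := by linarith
  obtain ⟨C₀, hm⟩ := hm
  obtain ⟨C, hC, hm⟩ : ∃ C : ℝ, 0 ≤ C ∧
      ∀ᶠ n : ℕ in atTop, |(m n : ℝ) - (n.choose 2 : ℝ) * p| ≤ C :=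
    ⟨|C₀|, abs_nonneg _, hm.mono fun n h => h.trans (le_abs_self _)⟩
  obtain ⟨l1, l2, l3⟩ := aux_limits x hx
  set K := (2 / (1 - p)) * (C + 1) + 16 / (1 - p) ^ 2 * (C ^ 2 + 1) with hK
  have hK0 : 0 ≤ K := by positivity
  set r := p / (1 - p) with hr
  have hr0 : 0 ≤ r := by positivity
  have hrb : 1 / (1 - p) - 1 = r := by rw [hr]; field_simp; ring
  rw [hrb]
  have hv : ∀ n : ℕ, 0 < (1 - p) ^ x n * Real.exp (-r * (x n : ℝ) ^ 2 / (n : ℝ) ^ 2) :=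
    fun n => by positivity
  rw [Asymptotics.isEquivalent_iff_tendsto_one (Eventually.of_forall fun n => (hv n).ne')]
  set E : ℕ → ℝ := fun n =>
    Real.log (((n.choose 2 - x n).choose (m n) : ℝ) / ((n.choose 2).choose (m n) : ℝ))
      - x n * Real.log (1 - p) + r * ((x n : ℝ) ^ 2 / (n : ℝ) ^ 2) with hE
  have hCn : Tendsto (fun n : ℕ => C / (n : ℝ) ^ 2) atTop (nhds 0) :=
    tendsto_const_nhds.div_atTop
      ((tendsto_pow_atTop (by norm_num)).comp tendsto_natCast_atTop_atTop)
  have hsmall : Tendsto (fun n : ℕ => C / (n : ℝ) ^ 2 + (x n : ℝ) / (n : ℝ) ^ 2)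
      atTop (nhds 0) := by simpa using hCn.add l1
  have ev1 := hsmall.eventually_lt_const (show (0 : ℝ) < (1 - p) / 16 by positivity)
  have main : ∀ᶠ n : ℕ in atTop,
      0 < ((n.choose 2 - x n).choose (m n) : ℝ) / ((n.choose 2).choose (m n) : ℝ) ∧
      |E n| ≤ K * (4 * ((x n : ℝ) / (n : ℝ) ^ 2) + 16 * ((x n : ℝ) ^ 3 / (n : ℝ) ^ 4))
        + r * (2 * ((x n : ℝ) ^ 2 / (n : ℝ) ^ 3) + 2 * ((x n : ℝ) / (n : ℝ) ^ 2)) := by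
    filter_upwards [hm, ev1, eventually_ge_atTop 2] with n hmn h1 hn
    have hn' : (2 : ℝ) ≤ n := by exact_mod_cast hn
    have hNeq : ((n.choose 2 : ℕ) : ℝ) = (n : ℝ) * (n - 1) / 2 := Nat.cast_choose_two ℝ n
    have hNlow : (n : ℝ) ^ 2 / 4 ≤ ((n.choose 2 : ℕ) : ℝ) := by rw [hNeq]; nlinarith
    have hN1 : 1 ≤ n.choose 2 := Nat.choose_pos hn
    have hn2 : (0 : ℝ) < (n : ℝ) ^ 2 := by positivity
    have hx0 : (0 : ℝ) ≤ x n := by positivity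
    have hsum : C + x n < (1 - p) / 16 * (n : ℝ) ^ 2 := by
      rwa [← add_div, div_lt_iff₀ hn2] at h1
    have hs : 4 * (C + x n) ≤ (1 - p) * ((n.choose 2 : ℕ) : ℝ) := by nlinarith
    have hX : 2 * (x n : ℝ) ≤ ((n.choose 2 : ℕ) : ℝ) := by nlinarith
    obtain ⟨hpos, hbd⟩ := aux_main p C (n.choose 2) (m n) (x n) hp0 hp1 hC hmn hN1 hX hs
    refine ⟨hpos, ?_⟩
    rw [← hK, ← hr] at hbd
    have b1 : (x n : ℝ) / ((n.choose 2 : ℕ) : ℝ) ≤ 4 * ((x n : ℝ) / (n : ℝ) ^ 2) := by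
      calc (x n : ℝ) / ((n.choose 2 : ℕ) : ℝ) ≤ (x n : ℝ) / ((n : ℝ) ^ 2 / 4) := by gcongr
        _ = _ := by field_simp
    have b2 : (x n : ℝ) ^ 3 / ((n.choose 2 : ℕ) : ℝ) ^ 2
        ≤ 16 * ((x n : ℝ) ^ 3 / (n : ℝ) ^ 4) := by
      calc (x n : ℝ) ^ 3 / ((n.choose 2 : ℕ) : ℝ) ^ 2
          ≤ (x n : ℝ) ^ 3 / ((n : ℝ) ^ 2 / 4) ^ 2 := by gcongr
        _ = _ := by field_simp; norm_num
    have hnm : (0 : ℝ) < (n : ℝ) - 1 := by linarith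
    have b3 : |(x n : ℝ) ^ 2 / (n : ℝ) ^ 2
          - (x n : ℝ) * (x n - 1) / (2 * ((n.choose 2 : ℕ) : ℝ))|
        ≤ 2 * ((x n : ℝ) ^ 2 / (n : ℝ) ^ 3) + 2 * ((x n : ℝ) / (n : ℝ) ^ 2) := by
      have e : (x n : ℝ) ^ 2 / (n : ℝ) ^ 2
          - (x n : ℝ) * (x n - 1) / (2 * ((n.choose 2 : ℕ) : ℝ))
          = (x n : ℝ) / ((n : ℝ) * (n - 1)) - (x n : ℝ) ^ 2 / ((n : ℝ) ^ 2 * (n - 1)) := by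
        rw [hNeq]; field_simp; ring
      rw [e]
      refine (abs_sub _ _).trans ?_
      rw [abs_of_nonneg (by positivity), abs_of_nonneg (by positivity)]
      have c1 : (x n : ℝ) / ((n : ℝ) * (n - 1)) ≤ 2 * ((x n : ℝ) / (n : ℝ) ^ 2) := by
        calc (x n : ℝ) / ((n : ℝ) * (n - 1)) ≤ (x n : ℝ) / ((n : ℝ) * (n / 2)) := by
              gcongr; linarith
          _ = _ := by field_simp
      have c2 : (x n : ℝ) ^ 2 / ((n : ℝ) ^ 2 * (n - 1)) ≤ 2 * ((x n : ℝ) ^ 2 / (n : ℝ) ^ 3) := by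
        calc (x n : ℝ) ^ 2 / ((n : ℝ) ^ 2 * (n - 1))
            ≤ (x n : ℝ) ^ 2 / ((n : ℝ) ^ 2 * (n / 2)) := by gcongr; linarith
          _ = _ := by field_simp
      linarith
    have eE : E n = (Real.log (((n.choose 2 - x n).choose (m n) : ℝ)
          / ((n.choose 2).choose (m n) : ℝ)) - x n * Real.log (1 - p)
          + r * ((x n : ℝ) * (x n - 1) / (2 * ((n.choose 2 : ℕ) : ℝ))))
        + r * ((x n : ℝ) ^ 2 / (n : ℝ) ^ 2
          - (x n : ℝ) * (x n - 1) / (2 * ((n.choose 2 : ℕ) : ℝ))) := by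
      rw [hE]; ring
    rw [eE]
    refine (abs_add_le _ _).trans (add_le_add (hbd.trans ?_) ?_)
    · gcongr
    · rw [abs_mul, abs_of_nonneg hr0]; gcongr
  have hElim : Tendsto E atTop (nhds 0) := by
    refine squeeze_zero_norm' (main.mono fun n h => h.2) ?_
    simpa using (((l1.const_mul 4).add (l2.const_mul 16)).const_mul K).add
      (((l3.const_mul 2).add (l1.const_mul 2)).const_mul r)
  have hexp : Tendsto (fun n => Real.exp (E n)) atTop (nhds 1) := by
    have h := (Real.continuous_exp.tendsto 0).comp hElim
    rw [Real.exp_zero] at h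
    exact h
  refine hexp.congr' (main.mono fun n h => ?_)
  rw [Pi.div_apply, eq_div_iff (hv n).ne']
  have hqp : (1 - p) ^ x n = Real.exp (x n * Real.log (1 - p)) := by
    rw [Real.exp_nat_mul, Real.exp_log hq0]
  rw [hqp, ← Real.exp_add, ← Real.exp_add]
  conv_rhs => rw [← Real.exp_log h.1]
  congr 1
  rw [hE]; ring
end

section
/- Fix i_0 ∈ {1,2}. Then the function x ↦ μ(i_0, x) is strictly decreasing and the function x ↦ λ(i_0, x) is strictly increasing on [0,1]. -/
open Filter
open scoped BigOperators

noncomputable section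

/-- `ζ_i = e^{λ + μ i − (ln 2 / 2) i²}`, where `λ, μ` depend on a parameter `x`. -/
def zetaF (lam mu : ℝ → ℝ) (x : ℝ) (i : ℕ) : ℝ :=
  Real.exp (lam x + mu x * (i : ℝ) - Real.log 2 / 2 * (i : ℝ) ^ 2)

/-- `T(x) = 1 + 2/ln 2 − x`. -/
def Tfun (x : ℝ) : ℝ := 1 + 2 / Real.log 2 - x

/-- `φ(s, x, i₀)` from (7.1). -/
def phiZ (lam mu : ℝ → ℝ) (i0 s : ℕ) (x : ℝ) : ℝ :=
  -(1 - ∑ i ∈ Finset.Icc i0 s, zetaF lam mu x i) *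
      Real.log (1 - ∑ i ∈ Finset.Icc i0 s, zetaF lam mu x i) +
    Real.log 2 / 2 * ∑ i ∈ Finset.Icc i0 s, zetaF lam mu x i * ((i : ℝ) - Tfun x)

/-- Lemma 7.15: `x ↦ μ(i₀,x)` is strictly decreasing and `x ↦ λ(i₀,x)` strictly increasing
on `[0,1]`, where `λ, μ` are determined by `Σ_{i≥i₀} ζ_i = 1` and `Σ_{i≥i₀} i ζ_i = T(x)`. -/
theorem mu_strictAnti_lambda_strictMono (i0 : ℕ) (hi0 : i0 = 1 ∨ i0 = 2)
    (lam mu : ℝ → ℝ)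
    (h1 : ∀ x ∈ Set.Icc (0:ℝ) 1, (∑' j : ℕ, zetaF lam mu x (i0 + j)) = 1)
    (h2 : ∀ x ∈ Set.Icc (0:ℝ) 1,
      (∑' j : ℕ, ((i0 + j : ℕ) : ℝ) * zetaF lam mu x (i0 + j)) = Tfun x) :
    StrictAntiOn mu (Set.Icc 0 1) ∧ StrictMonoOn lam (Set.Icc 0 1) := by
  have hT : ∀ x ∈ Set.Icc (0:ℝ) 1, Tfun x ≠ 0 := by
    intro x hx
    have hl : 0 < 2 / Real.log 2 := div_pos two_pos (Real.log_pos one_lt_two)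
    unfold Tfun
    have := hx.2
    linarith
  have s1 : ∀ x ∈ Set.Icc (0:ℝ) 1, Summable (fun j : ℕ => zetaF lam mu x (i0 + j)) := by
    intro x hx
    by_contra h
    have := h1 x hx
    rw [tsum_eq_zero_of_not_summable h] at this
    exact zero_ne_one this
  have s2 : ∀ x ∈ Set.Icc (0:ℝ) 1,
      Summable (fun j : ℕ => ((i0 + j : ℕ) : ℝ) * zetaF lam mu x (i0 + j)) := by
    intro x hx
    by_contra h
    have := h2 x hx
    rw [tsum_eq_zero_of_not_summable h] at this
    exact hT x hx this.symm
  have hi : ∀ j : ℕ, (1:ℝ) ≤ ((i0 + j : ℕ) : ℝ) := by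
    intro j
    have : 1 ≤ i0 + j := by omega
    exact_mod_cast this
  have key : ∀ x ∈ Set.Icc (0:ℝ) 1, ∀ y ∈ Set.Icc (0:ℝ) 1, x < y → mu y < mu x := by
    intro x hx y hy hxy
    have H1x := (h1 x hx) ▸ (s1 x hx).hasSum
    have H1y := (h1 y hy) ▸ (s1 y hy).hasSum
    have H2x := (h2 x hx) ▸ (s2 x hx).hasSum
    have H2y := (h2 y hy) ▸ (s2 y hy).hasSum
    have H := ((H1y.sub H1x).mul_left (lam y - lam x)).add
      ((H2y.sub H2x).mul_left (mu y - mu x))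
    have hnn := H.nonneg (by
      intro j
      have e : (lam y - lam x) * (zetaF lam mu y (i0 + j) - zetaF lam mu x (i0 + j)) +
          (mu y - mu x) * (((i0 + j : ℕ) : ℝ) * zetaF lam mu y (i0 + j) -
            ((i0 + j : ℕ) : ℝ) * zetaF lam mu x (i0 + j)) =
          ((lam y + mu y * ((i0 + j : ℕ) : ℝ) - Real.log 2 / 2 * ((i0 + j : ℕ) : ℝ) ^ 2) -
            (lam x + mu x * ((i0 + j : ℕ) : ℝ) - Real.log 2 / 2 * ((i0 + j : ℕ) : ℝ) ^ 2)) *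
          (zetaF lam mu y (i0 + j) - zetaF lam mu x (i0 + j)) := by ring
      show 0 ≤ _
      rw [e]
      unfold zetaF
      rcases le_total
        (lam y + mu y * ((i0 + j : ℕ) : ℝ) - Real.log 2 / 2 * ((i0 + j : ℕ) : ℝ) ^ 2)
        (lam x + mu x * ((i0 + j : ℕ) : ℝ) - Real.log 2 / 2 * ((i0 + j : ℕ) : ℝ) ^ 2) with h | h
      · exact mul_nonneg_of_nonpos_of_nonpos (sub_nonpos.2 h)
          (sub_nonpos.2 (Real.exp_le_exp.2 h))
      · exact mul_nonneg (sub_nonneg.2 h) (sub_nonneg.2 (Real.exp_le_exp.2 h)))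
    have hle : mu y ≤ mu x := by
      have : Tfun y - Tfun x = x - y := by unfold Tfun; ring
      rw [this] at hnn
      by_contra hc
      push Not at hc
      nlinarith [mul_pos (sub_pos.2 hc) (sub_pos.2 hxy)]
    refine lt_of_le_of_ne hle fun hmu => ?_
    have hz : ∀ i, zetaF lam mu y i = Real.exp (lam y - lam x) * zetaF lam mu x i := by
      intro i
      unfold zetaF
      rw [← Real.exp_add, hmu]
      congr 1
      ring
    have h3 := h1 y hy
    simp only [hz] at h3
    rw [tsum_mul_left, h1 x hx, mul_one] at h3
    have h4 := h2 y hy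
    simp only [hz, h3, one_mul] at h4
    rw [h2 x hx] at h4
    unfold Tfun at h4
    linarith
  refine ⟨fun x hx y hy hxy => key x hx y hy hxy, fun x hx y hy hxy => ?_⟩
  by_contra hc
  push Not at hc
  have hm := key x hx y hy hxy
  have hlt : ∀ j : ℕ, zetaF lam mu y (i0 + j) < zetaF lam mu x (i0 + j) := by
    intro j
    unfold zetaF
    apply Real.exp_lt_exp.2
    have := mul_lt_mul_of_pos_right hm (lt_of_lt_of_le one_pos (hi j))
    linarith
  have := (s1 y hy).tsum_lt_tsum (i := 0) (fun j => (hlt j).le) (hlt 0) (s1 x hx)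
  rw [h1 x hx, h1 y hy] at this
  exact lt_irrefl _ this
end
end

section
/- Let i_0 ∈ {1,2}. For every integer s ≥ 2, the infimum over x ∈ [0,1] of φ(s, x, i_0) is strictly positive. -/
open Filter
open scoped BigOperators

noncomputable section

/-- Positive sequences with `p (k+1) = p k * (a / 2^k)` and summable first moment. -/
structure PSeq (p : ℕ → ℝ) (a : ℝ) : Prop where
  pos : ∀ k, 0 < p k
  apos : 0 < a
  step : ∀ k, p (k + 1) = p k * (a / 2 ^ k)
  sum : Summable p
  sumk : Summable fun k : ℕ => (k : ℝ) * p k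

lemma PSeq.shift {p : ℕ → ℝ} {a : ℝ} (h : PSeq p a) (n : ℕ) :
    PSeq (fun k => p (n + k)) (a / 2 ^ n) where
  pos k := h.pos _
  apos := by have := h.apos; positivity
  step k := by
    have := h.step (n + k)
    rw [← add_assoc, this, pow_add, div_div]
  sum := by
    have := (summable_nat_add_iff n).2 h.sum
    simpa [add_comm] using this
  sumk := by
    have h1 := (summable_nat_add_iff n).2 h.sumk
    have h2 := ((summable_nat_add_iff n).2 h.sum).mul_left (n : ℝ)
    refine (h1.sub h2).congr fun k => ?_
    push_cast
    rw [add_comm n k]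
    ring

/-- Tail estimate: if `f (k+1) ≤ r f k` beyond `N` then the tail is controlled. -/
lemma tail_bound {f : ℕ → ℝ} (hf : Summable f) (N : ℕ) (r : ℝ)
    (h : ∀ k, N ≤ k → f (k + 1) ≤ r * f k) :
    (1 - r) * ∑' k, f (k + N) ≤ f N := by
  have hs : Summable fun k => f (k + N) := (summable_nat_add_iff N).2 hf
  have hs1 : Summable fun k => f (k + 1 + N) := (summable_nat_add_iff 1).2 hs
  have e := hs.tsum_eq_zero_add
  have hle : ∑' k, f (k + 1 + N) ≤ ∑' k, r * f (k + N) := by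
    refine Summable.tsum_le_tsum (fun k => ?_) hs1 (hs.mul_left r)
    have := h (k + N) (by omega)
    rwa [show k + 1 + N = k + N + 1 by ring]
  rw [tsum_mul_left] at hle
  simp only [zero_add] at e
  linarith

lemma PSeq.vals {p : ℕ → ℝ} {a : ℝ} (h : PSeq p a) :
    p 1 = p 0 * a ∧ p 2 = p 0 * (a ^ 2 / 2) ∧ p 3 = p 0 * (a ^ 3 / 8) ∧
    p 4 = p 0 * (a ^ 4 / 64) ∧ p 5 = p 0 * (a ^ 5 / 1024) := by
  have h1 := h.step 0
  have h2 := h.step 1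
  have h3 := h.step 2
  have h4 := h.step 3
  have h5 := h.step 4
  norm_num at h1 h2 h3 h4 h5
  refine ⟨h1, ?_, ?_, ?_, ?_⟩
  · rw [h2, h1]; ring
  · rw [h3, h2, h1]; ring
  · rw [h4, h3, h2, h1]; ring
  · rw [h5, h4, h3, h2, h1]; ring

/-- Ratio estimate for `k * p k`. -/
lemma PSeq.kratio {p : ℕ → ℝ} {a : ℝ} (h : PSeq p a) (N : ℕ) (hN : 1 ≤ N) (A : ℝ) (ha : a ≤ A)
    (k : ℕ) (hk : N ≤ k) :
    ((k + 1 : ℕ) : ℝ) * p (k + 1) ≤ ((1 + 1 / (N : ℝ)) * (A / 2 ^ N)) * ((k : ℝ) * p k) := by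
  rw [h.step]
  have hN0 : (0 : ℝ) < N := by exact_mod_cast hN
  have hkN : (N : ℝ) ≤ k := by exact_mod_cast hk
  have hk0 : (0 : ℝ) < k := by linarith
  have e1 : a / 2 ^ k ≤ A / 2 ^ N := by
    have h0 : 0 ≤ A := h.apos.le.trans ha
    gcongr
    norm_num
  have e2 : ((k + 1 : ℕ) : ℝ) ≤ (1 + 1 / (N : ℝ)) * k := by
    push_cast
    have : 1 ≤ (1 / (N : ℝ)) * k := by
      rw [one_div, inv_mul_eq_div, le_div_iff₀ hN0]; linarith
    linarith
  have e3 : 0 ≤ a / 2 ^ k := by have := h.apos; positivity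
  have hp := h.pos k
  calc ((k + 1 : ℕ) : ℝ) * (p k * (a / 2 ^ k)) ≤ ((1 + 1 / (N : ℝ)) * k) * (p k * (A / 2 ^ N)) := by
        gcongr
    _ = _ := by ring

/-- If `a ≤ 12/5`, the mean is below `1.88`. -/
lemma PSeq.mean_lt {p : ℕ → ℝ} {a : ℝ} (h : PSeq p a) (ha : a ≤ 12 / 5) :
    ∑' k : ℕ, (k : ℝ) * p k < 1.88 * ∑' k, p k := by
  have hT := tail_bound h.sumk 5 _ (h.kratio 5 (by norm_num) (12 / 5) ha)
  have e1 := h.sumk.sum_add_tsum_nat_add 5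
  have e2 := h.sum.sum_add_tsum_nat_add 3
  have e3 : 0 ≤ ∑' k, p (k + 3) := tsum_nonneg fun k => (h.pos _).le
  have e2' := h.sum.sum_add_tsum_nat_add 5
  have e3' : 0 ≤ ∑' k, p (k + 5) := tsum_nonneg fun k => (h.pos _).le
  obtain ⟨h1, h2, h3, h4, h5⟩ := h.vals
  rw [← e1, ← e2']
  simp only [Finset.sum_range_succ, Finset.sum_range_zero] at *
  norm_num at hT ⊢
  have hp := h.pos 0
  have ha0 := h.apos
  have b2 : a ^ 2 ≤ 2.4 * a := by nlinarith
  have b3 : a ^ 3 ≤ 5.76 * a := by nlinarith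
  have b4 : a ^ 4 ≤ 13.824 * a := by nlinarith
  have b5 : a ^ 5 ≤ 33.1776 * a := by nlinarith
  have key : -1.88 - 0.88 * a + 0.12 * (a ^ 2 / 2) + 1.12 * (a ^ 3 / 8) + 2.12 * (a ^ 4 / 64)
      + 5.5 * (a ^ 5 / 1024) < 0 := by linarith
  have key2 := mul_neg_of_pos_of_neg hp key
  have hp5 := h.pos 5
  have hV : ∑' k : ℕ, ((k : ℝ) + 5) * p (k + 5) ≤ 5.5 * p 5 := by linarith
  rw [h5] at hV
  rw [h1, h2, h3, h4]
  nlinarith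

lemma PSeq.lower {p : ℕ → ℝ} {a : ℝ} (h : PSeq p a) (h1 : ∑' k, p k = 1)
    (hc : 0.88 ≤ ∑' k : ℕ, (k : ℝ) * p k) : 1 / 4 ≤ a := by
  by_contra! ha
  have hT := tail_bound h.sumk 1 _ (h.kratio 1 (by norm_num) (1 / 4) ha.le)
  have e1 := h.sumk.sum_add_tsum_nat_add 1
  have e2 := h.sum.sum_add_tsum_nat_add 1
  have e3 : 0 ≤ ∑' k, p (k + 1) := tsum_nonneg fun k => (h.pos _).le
  obtain ⟨v1, -⟩ := h.vals
  simp only [Finset.sum_range_succ, Finset.sum_range_zero] at *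
  norm_num at hT e1 e2
  rw [v1] at hT
  have hp := h.pos 0
  nlinarith

/-- Lower bound for the first moment by finitely many terms. -/
lemma PSeq.partial_le {p : ℕ → ℝ} {a : ℝ} (h : PSeq p a) (h1 : ∑' k, p k = 1) (d : ℝ) (N : ℕ)
    (hd : d ≤ N) :
    ∑ k ∈ Finset.range N, ((k : ℝ) - d) * p k ≤ (∑' k : ℕ, (k : ℝ) * p k) - d := by
  have hs : Summable fun k : ℕ => ((k : ℝ) - d) * p k :=
    (h.sumk.sub (h.sum.mul_left d)).congr fun k => by ring
  have e : ∑' k : ℕ, ((k : ℝ) - d) * p k = (∑' k : ℕ, (k : ℝ) * p k) - d := by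
    have : (fun k : ℕ => ((k : ℝ) - d) * p k) = fun k : ℕ => (k : ℝ) * p k - d * p k := by
      ext k; ring
    rw [this, h.sumk.tsum_sub (h.sum.mul_left d), tsum_mul_left, h1, mul_one]
  rw [← e]
  refine hs.sum_le_tsum _ fun k hk => ?_
  have : N ≤ k := by simpa using hk
  have : (N : ℝ) ≤ k := by exact_mod_cast this
  exact mul_nonneg (by linarith) (h.pos k).le

lemma PSeq.upper1 {p : ℕ → ℝ} {a : ℝ} (h : PSeq p a) (h1 : ∑' k, p k = 1)
    (hc : ∑' k : ℕ, (k : ℝ) * p k ≤ 1.89) : a ≤ 24 / 5 := by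
  by_contra! ha
  have e := h.partial_le h1 1.89 4 (by norm_num)
  obtain ⟨v1, v2, v3, v4, v5⟩ := h.vals
  simp only [Finset.sum_range_succ, Finset.sum_range_zero, v1, v2, v3] at e
  have hp := h.pos 0
  have b2 : 4.8 * a ≤ a ^ 2 := by nlinarith
  have b3 : 23.04 * a ≤ a ^ 3 := by nlinarith
  have key : 0 < -1.89 - 0.89 * a + 0.11 * (a ^ 2 / 2) + 1.11 * (a ^ 3 / 8) := by linarith
  have := mul_pos hp key
  norm_num at e
  nlinarith

lemma PSeq.upper2 {p : ℕ → ℝ} {a : ℝ} (h : PSeq p a) (h1 : ∑' k, p k = 1)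
    (hc : ∑' k : ℕ, (k : ℝ) * p k ≤ 3) : a ≤ 16 := by
  by_contra! ha
  have e := h.partial_le h1 3 5 (by norm_num)
  obtain ⟨v1, v2, v3, v4, v5⟩ := h.vals
  simp only [Finset.sum_range_succ, Finset.sum_range_zero, v1, v2, v3, v4] at e
  have hp := h.pos 0
  have b2 : 16 * a ≤ a ^ 2 := by nlinarith
  have b3 : 16 * a ^ 2 ≤ a ^ 3 := by nlinarith
  have b4 : 16 * a ^ 3 ≤ a ^ 4 := by nlinarith [pow_pos h.apos 3]
  have key : 0 < -3 - 2 * a - (a ^ 2 / 2) + (a ^ 4 / 64) := by linarith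
  have := mul_pos hp key
  norm_num at e
  nlinarith

lemma PSeq.p0_lower {p : ℕ → ℝ} {a : ℝ} (h : PSeq p a) (h1 : ∑' k, p k = 1)
    (ha : a ≤ 16) : 1 / 16 ^ 6 ≤ p 0 := by
  have hT := tail_bound h.sum 5 (1 / 2) (fun k hk => by
    rw [h.step, mul_comm]
    have := h.pos k
    refine mul_le_mul_of_nonneg_right ?_ this.le
    have : (2 : ℝ) ^ 5 ≤ 2 ^ k := by gcongr; norm_num
    rw [div_le_div_iff₀ (by positivity) (by norm_num)]
    linarith)
  have e := h.sum.sum_add_tsum_nat_add 5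
  obtain ⟨v1, v2, v3, v4, v5⟩ := h.vals
  rw [h1] at e
  simp only [Finset.sum_range_succ, Finset.sum_range_zero, v1, v2, v3, v4] at e
  rw [v5] at hT
  have hp := h.pos 0
  have ha0 := h.apos
  have b2 : a ^ 2 ≤ 16 ^ 2 := by gcongr
  have b3 : a ^ 3 ≤ 16 ^ 3 := by gcongr
  have b4 : a ^ 4 ≤ 16 ^ 4 := by gcongr
  have b5 : a ^ 5 ≤ 16 ^ 5 := by gcongr
  have key : 1 + a + a ^ 2 / 2 + a ^ 3 / 8 + a ^ 4 / 64 + 2 * (a ^ 5 / 1024) ≤ 16 ^ 6 := by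
    linarith
  have := mul_le_mul_of_nonneg_left key hp.le
  rw [div_le_iff₀ (by norm_num)]
  linarith

lemma uniform_lower (k : ℕ) : ∃ δ : ℝ, 0 < δ ∧ ∀ (p : ℕ → ℝ) (a : ℝ), PSeq p a →
    ∑' k, p k = 1 → 1 / 4 ≤ a → a ≤ 16 → δ ≤ p k := by
  induction k with
  | zero => exact ⟨1 / 16 ^ 6, by positivity, fun p a h h1 _ ha => h.p0_lower h1 ha⟩
  | succ k ih =>
    obtain ⟨δ, hδ, H⟩ := ih
    refine ⟨δ * ((1 / 4) / 2 ^ k), by positivity, fun p a h h1 h2 h3 => ?_⟩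
    rw [h.step]
    have := H p a h h1 h2 h3
    have hp := h.pos k
    gcongr

/-- The bracket `B n`. -/
def Bfun (p : ℕ → ℝ) (c : ℝ) (n : ℕ) : ℝ :=
  -Real.log (1 - ∑ k ∈ Finset.range n, p k) -
    Real.log 2 / 2 * ((c - ∑ k ∈ Finset.range n, (k : ℝ) * p k) /
      (1 - ∑ k ∈ Finset.range n, p k) - c)

lemma PSeq.R_pos {p : ℕ → ℝ} {a : ℝ} (h : PSeq p a) (h1 : ∑' k, p k = 1) (n : ℕ) :
    p n ≤ 1 - ∑ k ∈ Finset.range n, p k := by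
  have := h.sum.sum_le_tsum (Finset.range (n + 1)) (fun k _ => (h.pos k).le)
  rw [Finset.sum_range_succ, h1] at this
  linarith

/-- The mean residual bound. -/
lemma PSeq.g_bound {p : ℕ → ℝ} {a : ℝ} (h : PSeq p a) (h1 : ∑' k, p k = 1) (n : ℕ)
    (ha : a / 2 ^ n ≤ 12 / 5) :
    Real.log 2 / 2 * (((∑' k : ℕ, (k : ℝ) * p k) - ∑ k ∈ Finset.range n, (k : ℝ) * p k) -
      ((n : ℝ) - 1) * (1 - ∑ k ∈ Finset.range n, p k)) ≤ 1 - ∑ k ∈ Finset.range n, p k := by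
  have hm := (h.shift n).mean_lt ha
  have e1 := h.sum.sum_add_tsum_nat_add n
  have e2 := h.sumk.sum_add_tsum_nat_add n
  have s1 := (summable_nat_add_iff n).2 h.sumk
  have s2 := (summable_nat_add_iff n).2 h.sum
  have e3 : ∑' k : ℕ, (k : ℝ) * p (n + k) =
      (∑' k : ℕ, ((k + n : ℕ) : ℝ) * p (k + n)) - n * ∑' k, p (k + n) := by
    rw [← tsum_mul_left, ← s1.tsum_sub (s2.mul_left _)]
    refine tsum_congr fun k => ?_
    push_cast
    rw [add_comm n k]
    ring
  have e4 : ∑' k : ℕ, p (n + k) = ∑' k, p (k + n) := tsum_congr fun k => by rw [add_comm]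
  rw [e3, e4] at hm
  have hR := h.R_pos h1 n
  have hpn := h.pos n
  rw [h1] at e1
  set R := 1 - ∑ k ∈ Finset.range n, p k with hRdef
  have e5 : ∑' k, p (k + n) = R := by linarith
  have e6 : (∑' k : ℕ, (k : ℝ) * p k) - ∑ k ∈ Finset.range n, (k : ℝ) * p k =
    ∑' k : ℕ, ((k + n : ℕ) : ℝ) * p (k + n) := by linarith
  rw [e6]
  rw [e5] at hm
  have l1 := Real.log_two_lt_d9
  have l2 := Real.log_two_gt_d9
  have : (∑' k : ℕ, ((k + n : ℕ) : ℝ) * p (k + n)) - ((n : ℝ) - 1) * R ≤ 2.88 * R := by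
    linarith
  have hR0 : 0 < R := by linarith
  calc _ ≤ Real.log 2 / 2 * (2.88 * R) := by gcongr
    _ ≤ R := by nlinarith

lemma PSeq.B_step {p : ℕ → ℝ} {a : ℝ} (h : PSeq p a) (h1 : ∑' k, p k = 1) (n : ℕ)
    (ha : a / 2 ^ (n + 1) ≤ 12 / 5) :
    -Real.log (1 - p n / (1 - ∑ k ∈ Finset.range n, p k)) -
        p n / (1 - ∑ k ∈ Finset.range n, p k) ≤
      Bfun p (∑' k : ℕ, (k : ℝ) * p k) (n + 1) - Bfun p (∑' k : ℕ, (k : ℝ) * p k) n := by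
  have hg := h.g_bound h1 (n + 1) ha
  have hR := h.R_pos h1 n
  have hR' := h.R_pos h1 (n + 1)
  have hp := h.pos n
  have hp' := h.pos (n + 1)
  unfold Bfun
  rw [Finset.sum_range_succ, Finset.sum_range_succ] at *
  set c := ∑' k : ℕ, (k : ℝ) * p k
  set S := ∑ k ∈ Finset.range n, p k
  set M := ∑ k ∈ Finset.range n, (k : ℝ) * p k
  have hRp : 0 < 1 - S := by linarith
  have hRp' : 0 < 1 - (S + p n) := by linarith
  have hlog : 1 - p n / (1 - S) = (1 - (S + p n)) / (1 - S) := by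
    field_simp; ring
  rw [hlog, Real.log_div hRp'.ne' hRp.ne']
  have hfrac : (c - (M + n * p n)) / (1 - (S + p n)) - (c - M) / (1 - S) =
      p n / (1 - S) * (((c - (M + n * p n)) - n * (1 - (S + p n))) / (1 - (S + p n))) := by
    field_simp
    ring
  have hb : Real.log 2 / 2 * (((c - (M + n * p n)) - n * (1 - (S + p n))) / (1 - (S + p n))) ≤ 1 := by
    rw [← mul_div_assoc, div_le_one hRp']
    push_cast at hg
    simpa using hg
  have hq : 0 < p n / (1 - S) := by positivity
  have := mul_le_mul_of_nonneg_left hb hq.le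
  have e : Real.log 2 / 2 * ((c - (M + n * p n)) / (1 - (S + p n)) - c) -
      Real.log 2 / 2 * ((c - M) / (1 - S) - c) = p n / (1 - S) * (Real.log 2 / 2 *
      (((c - (M + n * p n)) - n * (1 - (S + p n))) / (1 - (S + p n)))) := by
    rw [← mul_sub, sub_sub_sub_cancel_right, hfrac]; ring
  linarith

lemma neg_log_ge (u : ℝ) (h0 : 0 ≤ u) (h1 : u < 1) :
    u + u ^ 2 / 2 + u ^ 3 / 3 + u ^ 4 / 4 ≤ -Real.log (1 - u) := by
  have H := Real.hasSum_pow_div_log_of_abs_lt_one (x := u) (by rw [abs_of_nonneg h0]; exact h1)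
  have := sum_le_hasSum (Finset.range 4) (fun k _ => by positivity) H
  simp only [Finset.sum_range_succ, Finset.sum_range_zero] at this
  norm_num at this
  linarith

lemma PSeq.B_mono {p : ℕ → ℝ} {a : ℝ} (h : PSeq p a) (h1 : ∑' k, p k = 1) (n : ℕ)
    (ha : a / 2 ^ (n + 1) ≤ 12 / 5) (m : ℕ) (hm : n ≤ m) :
    Bfun p (∑' k : ℕ, (k : ℝ) * p k) n ≤ Bfun p (∑' k : ℕ, (k : ℝ) * p k) m := by
  induction m, hm using Nat.le_induction with
  | base => exact le_rfl
  | succ m hm ih =>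
    have ha' : a / 2 ^ (m + 1) ≤ 12 / 5 := by
      refine le_trans ?_ ha
      have := h.apos
      gcongr
      norm_num
    have hs := h.B_step h1 m ha'
    have hR := h.R_pos h1 m
    have hR' := h.R_pos h1 (m + 1)
    rw [Finset.sum_range_succ] at hR'
    have hp := h.pos m
    have hp' := h.pos (m + 1)
    set q := p m / (1 - ∑ k ∈ Finset.range m, p k) with hq
    have hq0 : 0 ≤ q := div_nonneg hp.le (by linarith)
    have hq1 : q < 1 := by rw [hq, div_lt_one (by linarith)]; linarith
    have := neg_log_ge q hq0 hq1
    have : q ≤ -Real.log (1 - q) := le_trans (by nlinarith [pow_nonneg hq0 3, pow_nonneg hq0 4, pow_nonneg hq0 2]) this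
    linarith

/-- Base case for `i₀ = 2`. -/
lemma PSeq.base_two {p : ℕ → ℝ} {a : ℝ} (h : PSeq p a) (h1 : ∑' k, p k = 1) (ha : a ≤ 24 / 5) :
    p 0 ^ 2 / 2 ≤ Bfun p (∑' k : ℕ, (k : ℝ) * p k) 1 := by
  have hs := h.B_step h1 0 (by norm_num; linarith)
  have hR' := h.R_pos h1 1
  have hp := h.pos 0
  have hp' := h.pos 1
  have h0 : Bfun p (∑' k : ℕ, (k : ℝ) * p k) 0 = 0 := by simp [Bfun]
  rw [h0] at hs
  simp at hs hR'
  have := neg_log_ge (p 0) hp.le (by linarith)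
  nlinarith [pow_pos hp 3, pow_pos hp 4]

lemma poly_bound (u : ℝ) (h0 : 0 ≤ u) (h4 : u ≤ 0.4) :
    0.76 * u ≤ (1 - u) * (u + u ^ 2 / 2 + u ^ 3 / 3 + u ^ 4 / 4) := by
  have g2 : u ^ 2 ≤ 0.4 ^ 2 := by gcongr
  have g3 : u ^ 3 ≤ 0.4 ^ 3 := by gcongr
  have g4 : u ^ 4 ≤ 0.4 ^ 4 := by gcongr
  have h : 0.76 ≤ 1 - u / 2 - u ^ 2 / 6 - u ^ 3 / 12 - u ^ 4 / 4 := by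
    norm_num at *
    linarith
  have := mul_le_mul_of_nonneg_left h h0
  linarith

/-- Base case for `i₀ = 1`. -/
lemma PSeq.base_one {p : ℕ → ℝ} {a : ℝ} (h : PSeq p a) (h1 : ∑' k, p k = 1)
    (hc : 1.88 ≤ ∑' k : ℕ, (k : ℝ) * p k)
    (hc' : Real.log 2 / 2 * ∑' k : ℕ, (k : ℝ) * p k ≤ 1) :
    p 0 / 1000 ≤ Bfun p (∑' k : ℕ, (k : ℝ) * p k) 2 := by
  have ha : 12 / 5 ≤ a := by
    by_contra! ha
    have := h.mean_lt ha.le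
    rw [h1] at this
    linarith
  have hS := h.sum.sum_le_tsum (Finset.range 5) (fun k _ => (h.pos k).le)
  obtain ⟨v1, v2, v3, v4, v5⟩ := h.vals
  have hp := h.pos 0
  have hp1 := h.pos 1
  rw [h1] at hS
  simp only [Finset.sum_range_succ, Finset.sum_range_zero, v2, v3, v4] at hS
  set c := ∑' k : ℕ, (k : ℝ) * p k
  set u := p 0 + p 1 with hu
  have ha0 := h.apos
  have b2 : 2.4 * a ≤ a ^ 2 := by nlinarith
  have b3 : 5.76 * a ≤ a ^ 3 := by nlinarith
  have b4 : 13.824 * a ≤ a ^ 4 := by nlinarith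
  have hu4 : u ≤ 0.4 := by
    have key : 1.5 * (1 + a) ≤ a ^ 2 / 2 + a ^ 3 / 8 + a ^ 4 / 64 := by linarith
    have := mul_le_mul_of_nonneg_left key hp.le
    have : 1.5 * u ≤ 1 - u := by rw [hu, v1] at *; linarith
    linarith
  have hu1 : 12 / 17 * u ≤ p 1 := by
    rw [hu, v1]; nlinarith
  have hu0 : 0 < u := by positivity
  have hlog := neg_log_ge u hu0.le (by linarith)
  have hR : 0 < 1 - u := by linarith
  have hB : Bfun p c 2 = -Real.log (1 - u) - Real.log 2 / 2 * ((c - p 1) / (1 - u) - c) := by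
    simp [Bfun, Finset.sum_range_succ, hu]
  have l1 := Real.log_two_lt_d9
  have l2 := Real.log_two_gt_d9
  have hmain : u / 1000 ≤ (1 - u) * Bfun p c 2 := by
    have e : (1 - u) * Bfun p c 2 = (1 - u) * (-Real.log (1 - u)) -
        (Real.log 2 / 2 * c) * u + Real.log 2 / 2 * p 1 := by
      rw [hB]; field_simp; ring
    rw [e]
    have f1 : (Real.log 2 / 2 * c) * u ≤ 1 * u := by gcongr
    have f2 : 0.3465 * (12 / 17 * u) ≤ Real.log 2 / 2 * p 1 := by
      apply mul_le_mul _ hu1 (by positivity) (by positivity); linarith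
    have f3 : (1 - u) * (u + u ^ 2 / 2 + u ^ 3 / 3 + u ^ 4 / 4) ≤ (1 - u) * (-Real.log (1 - u)) := by
      gcongr
    have f4 : 0.76 * u ≤ (1 - u) * (u + u ^ 2 / 2 + u ^ 3 / 3 + u ^ 4 / 4) := poly_bound u hu0.le hu4
    linarith
  have hBpos : 0 ≤ Bfun p c 2 := by
    by_contra! hneg
    nlinarith
  have : (1 - u) * Bfun p c 2 ≤ Bfun p c 2 := by nlinarith
  linarith

lemma exp_pseq (lam mu : ℝ → ℝ) (x : ℝ) (i0 : ℕ)
    (hs : Summable fun j : ℕ => zetaF lam mu x (i0 + j))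
    (hk : Summable fun j : ℕ => ((i0 + j : ℕ) : ℝ) * zetaF lam mu x (i0 + j)) :
    PSeq (fun j => zetaF lam mu x (i0 + j))
      (Real.exp (mu x - Real.log 2 / 2 * (2 * i0 + 1))) where
  pos k := Real.exp_pos _
  apos := Real.exp_pos _
  step k := by
    have : (2 : ℝ) ^ k = Real.exp (Real.log 2 * k) := by
      rw [mul_comm, Real.exp_nat_mul, Real.exp_log (by norm_num)]
    rw [this, ← Real.exp_sub]
    unfold zetaF
    rw [← Real.exp_add]
    congr 1
    push_cast
    ring
  sum := hs
  sumk := (hk.sub (hs.mul_left (i0 : ℝ))).congr fun k => by push_cast; ring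

/-- Lemma 7.11: for `i₀ ∈ {1,2}` and every `s ≥ 2`,
`inf_{x ∈ [0,1]} φ(s, x, i₀) > 0`. -/
theorem phi_inf_pos (i0 : ℕ) (hi0 : i0 = 1 ∨ i0 = 2)
    (lam mu : ℝ → ℝ)
    (h1 : ∀ x ∈ Set.Icc (0:ℝ) 1, (∑' j : ℕ, zetaF lam mu x (i0 + j)) = 1)
    (h2 : ∀ x ∈ Set.Icc (0:ℝ) 1,
      (∑' j : ℕ, ((i0 + j : ℕ) : ℝ) * zetaF lam mu x (i0 + j)) = Tfun x)
    (s : ℕ) (hs : 2 ≤ s) :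
    ∃ ε : ℝ, 0 < ε ∧ ∀ x ∈ Set.Icc (0:ℝ) 1, ε ≤ phiZ lam mu i0 s x := by
  have l1 := Real.log_two_lt_d9
  have l2 := Real.log_two_gt_d9
  have hL : 0 < Real.log 2 := by linarith
  have t1 : 2.885 < 2 / Real.log 2 := by rw [lt_div_iff₀ hL]; linarith
  have t2 : 2 / Real.log 2 < 2.886 := by rw [div_lt_iff₀ hL]; linarith
  obtain ⟨n, hn⟩ : ∃ n, s + 1 = i0 + n := ⟨s + 1 - i0, by omega⟩
  obtain ⟨δ0, hδ0, H0⟩ := uniform_lower 0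
  obtain ⟨δ, hδ, H⟩ := uniform_lower n
  refine ⟨δ * min (δ0 / 1000) (δ0 ^ 2 / 2), by positivity, fun x hx => ?_⟩
  have g1 := h1 x hx
  have g2 := h2 x hx
  obtain ⟨hx0, hx1⟩ := hx
  have hi : (i0 : ℝ) = 1 ∨ (i0 : ℝ) = 2 := by
    rcases hi0 with h | h <;> simp [h]
  have hT : Tfun x = 1 + 2 / Real.log 2 - x := rfl
  have hs1 : Summable fun j : ℕ => zetaF lam mu x (i0 + j) := by
    by_contra hc
    rw [tsum_eq_zero_of_not_summable hc] at g1
    norm_num at g1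
  have hs2 : Summable fun j : ℕ => ((i0 + j : ℕ) : ℝ) * zetaF lam mu x (i0 + j) := by
    by_contra hc
    rw [tsum_eq_zero_of_not_summable hc] at g2
    linarith
  have hP := exp_pseq lam mu x i0 hs1 hs2
  set a := Real.exp (mu x - Real.log 2 / 2 * (2 * i0 + 1))
  set p : ℕ → ℝ := fun j => zetaF lam mu x (i0 + j) with hp
  have hmean : ∑' k : ℕ, (k : ℝ) * p k = Tfun x - i0 := by
    have : (fun k : ℕ => (k : ℝ) * p k) =
        fun k : ℕ => ((i0 + k : ℕ) : ℝ) * zetaF lam mu x (i0 + k) - i0 * p k := by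
      ext k; simp only [hp]; push_cast; ring
    rw [this, hs2.tsum_sub (hs1.mul_left _), tsum_mul_left, g1, g2, mul_one]
  have ha1 : 1 / 4 ≤ a := hP.lower g1 (by rw [hmean]; rcases hi with h | h <;> rw [h] <;> linarith)
  have ha2 : a ≤ 16 := hP.upper2 g1 (by rw [hmean]; rcases hi with h | h <;> rw [h] <;> linarith)
  have hp0 := H0 p a hP g1 ha1 ha2
  have hpn := H p a hP g1 ha1 ha2
  have hB : min (δ0 / 1000) (δ0 ^ 2 / 2) ≤ Bfun p (∑' k : ℕ, (k : ℝ) * p k) n := by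
    rcases hi0 with h | h
    · have hi1 : (i0 : ℝ) = 1 := by simp [h]
      have hb := hP.base_one g1 (by rw [hmean, hi1]; linarith) (by
        rw [hmean, hi1, hT]
        have : Real.log 2 / 2 * (1 + 2 / Real.log 2 - x - 1) = 1 - Real.log 2 / 2 * x := by
          field_simp
          try ring
        rw [this]
        have : 0 ≤ Real.log 2 / 2 * x := by positivity
        linarith)
      have hm := hP.B_mono g1 2 (by norm_num; linarith) n (by omega)
      refine (min_le_left _ _).trans ?_
      linarith
    · have hi1 : (i0 : ℝ) = 2 := by simp [h]
      have ha3 := hP.upper1 g1 (by rw [hmean, hi1]; linarith)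
      have hb := hP.base_two g1 ha3
      have hm := hP.B_mono g1 1 (by norm_num; linarith) n (by omega)
      refine (min_le_right _ _).trans ?_
      have : δ0 ^ 2 ≤ p 0 ^ 2 := by gcongr
      linarith
  have hR := hP.R_pos g1 n
  have hsum : ∀ f : ℕ → ℝ, ∑ i ∈ Finset.Icc i0 s, f i = ∑ k ∈ Finset.range n, f (i0 + k) := by
    intro f
    have : Finset.Icc i0 s = Finset.Ico i0 (s + 1) := by ext; simp
    rw [this, Finset.sum_Ico_eq_sum_range, hn, Nat.add_sub_cancel_left]
  have hphi : phiZ lam mu i0 s x = (1 - ∑ k ∈ Finset.range n, p k) *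
      Bfun p (∑' k : ℕ, (k : ℝ) * p k) n := by
    have hR0 : 1 - ∑ k ∈ Finset.range n, p k ≠ 0 := by
      have := hP.pos n
      linarith
    unfold phiZ Bfun
    rw [hsum, hsum]
    have : ∑ k ∈ Finset.range n, zetaF lam mu x (i0 + k) * (((i0 + k : ℕ) : ℝ) - Tfun x) =
        ∑ k ∈ Finset.range n, (k : ℝ) * p k - (Tfun x - i0) * ∑ k ∈ Finset.range n, p k := by
      rw [Finset.mul_sum, ← Finset.sum_sub_distrib]
      refine Finset.sum_congr rfl fun k _ => ?_
      simp only [hp]; push_cast; ring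
    rw [this, hmean]
    change -(1 - ∑ k ∈ Finset.range n, p k) * Real.log (1 - ∑ k ∈ Finset.range n, p k) + _ = _
    field_simp
    try ring
  rw [hphi]
  have : 0 < min (δ0 / 1000) (δ0 ^ 2 / 2) := by positivity
  exact mul_le_mul (hpn.trans hR) hB this.le (by linarith)
end
end

section
/- Let i_0 = s = 1. Then the infimum over x ∈ [0.04, 1] of φ(1, x, 1) is strictly positive. -/
open Filter
open scoped BigOperators

noncomputable section

/-- Normalised weights. -/
def wgt (a : ℝ) (j : ℕ) : ℝ := a ^ j / 2 ^ (j.choose 2)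

lemma wgt_nonneg {a : ℝ} (ha : 0 ≤ a) (j : ℕ) : 0 ≤ wgt a j := by
  unfold wgt; positivity

lemma wgt_succ (a : ℝ) (j : ℕ) : wgt a (j + 1) = wgt a j * (a / 2 ^ j) := by
  unfold wgt
  have : (j + 1).choose 2 = j + j.choose 2 := by
    rw [Nat.choose_succ_succ' j 1, Nat.choose_one_right]
  rw [this, pow_add 2, pow_succ]
  field_simp

lemma wgt_mono {a b : ℝ} (ha : 0 ≤ a) (hab : a ≤ b) (j : ℕ) : wgt a j ≤ wgt b j := by
  unfold wgt; gcongr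

lemma wgt_scale {a b : ℝ} (hb : 0 < b) (j : ℕ) : wgt a j = (a / b) ^ j * wgt b j := by
  unfold wgt; rw [div_pow]; field_simp

lemma key {a b p q κ Fa Na Fb Nb : ℝ} (m : ℕ) (ha : 0 < a) (hab : a ≤ b)
    (hc1 : ∀ j : ℕ, j ≤ m → 0 ≤ p - q * j - (if j = 0 then κ else 0))
    (hc2 : ∀ j : ℕ, m < j → p - q * j - (if j = 0 then κ else 0) ≤ 0)
    (hFa : HasSum (wgt a) Fa) (hNa : HasSum (fun j : ℕ => (j : ℝ) * wgt a j) Na)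
    (hFb : HasSum (wgt b) Fb) (hNb : HasSum (fun j : ℕ => (j : ℝ) * wgt b j) Nb) :
    (a / b) ^ m * (p * Fb - q * Nb - κ) ≤ p * Fa - q * Na - κ := by
  have hb : 0 < b := ha.trans_le hab
  have A : ∀ a Fa Na : ℝ, HasSum (wgt a) Fa → HasSum (fun j : ℕ => (j : ℝ) * wgt a j) Na →
      HasSum (fun j : ℕ => (p - q * j - (if j = 0 then κ else 0)) * wgt a j)
        (p * Fa - q * Na - κ) := by
    intro a Fa Na h1 h2
    have h3 := ((h1.mul_left p).sub (h2.mul_left q)).sub (hasSum_ite_eq (0 : ℕ) κ)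
    refine h3.congr_fun ?_
    intro j
    by_cases hj : j = 0
    · subst hj; simp [wgt]
    · simp [hj]; ring
  refine hasSum_le ?_ ((A b Fb Nb hFb hNb).mul_left ((a / b) ^ m)) (A a Fa Na hFa hNa)
  intro j
  rw [wgt_scale (a := a) hb j]
  have hr0 : 0 ≤ a / b := by positivity
  have hr1 : a / b ≤ 1 := (div_le_one hb).2 hab
  have hw := wgt_nonneg hb.le j
  generalize hC : p - q * (j : ℝ) - (if j = 0 then κ else 0) = C
  have : (a / b) ^ m * C ≤ (a / b) ^ j * C := by
    rcases le_or_gt j m with h | h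
    · have := hc1 j h
      rw [hC] at this
      exact mul_le_mul_of_nonneg_right (pow_le_pow_of_le_one hr0 hr1 h) this
    · have := hc2 j h
      rw [hC] at this
      exact mul_le_mul_of_nonpos_right (pow_le_pow_of_le_one hr0 hr1 h.le) this
  nlinarith [mul_le_mul_of_nonneg_right this hw]

lemma tail_term (k : ℕ) :
    ((k + 8 : ℕ) : ℝ) * wgt 5.06 (k + 8) ≤ 0.014 * (1 / 4) ^ k := by
  induction k with
  | zero => norm_num [wgt, Nat.choose]
  | succ k ih =>
    rw [show k + 1 + 8 = (k + 8) + 1 by ring, wgt_succ]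
    have hw := wgt_nonneg (a := 5.06) (by norm_num) (k + 8)
    have h2 : (5.06 : ℝ) / 2 ^ (k + 8) ≤ 5.06 / 256 := by
      have : (1 : ℝ) ≤ 2 ^ k := one_le_pow₀ (by norm_num)
      gcongr
      rw [pow_add]; nlinarith
    have h3 : (((k + 8 + 1 : ℕ) : ℝ)) ≤ 2 * ((k + 8 : ℕ) : ℝ) := by
      push_cast; linarith [(Nat.cast_nonneg k : (0 : ℝ) ≤ k)]
    have h4 : 0 ≤ ((k + 8 : ℕ) : ℝ) * wgt 5.06 (k + 8) := by positivity
    calc ((k + 8 + 1 : ℕ) : ℝ) * (wgt 5.06 (k + 8) * (5.06 / 2 ^ (k + 8)))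
        ≤ (2 * ((k + 8 : ℕ) : ℝ)) * (wgt 5.06 (k + 8) * (5.06 / 256)) := by gcongr
      _ = (((k + 8 : ℕ) : ℝ) * wgt 5.06 (k + 8)) * (2 * (5.06 / 256)) := by ring
      _ ≤ (((k + 8 : ℕ) : ℝ) * wgt 5.06 (k + 8)) * (1 / 4) := by
          apply mul_le_mul_of_nonneg_left _ h4; norm_num
      _ ≤ (0.014 * (1 / 4) ^ k) * (1 / 4) := by gcongr
      _ = _ := by ring

lemma bounded_sum {f : ℕ → ℝ} (h0 : ∀ j, 0 ≤ f j)
    (h : ∀ k, f (k + 8) ≤ 0.014 * (1 / 4) ^ k) :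
    ∃ S, HasSum f S ∧ ∑ j ∈ Finset.range 8, f j ≤ S ∧
      S ≤ ∑ j ∈ Finset.range 8, f j + 0.019 := by
  have hg : HasSum (fun k : ℕ => (0.014 : ℝ) * (1 / 4) ^ k) (0.014 * (1 - 1 / 4)⁻¹) :=
    (hasSum_geometric_of_lt_one (by norm_num) (by norm_num)).mul_left _
  have hs : Summable (fun k => f (k + 8)) := Summable.of_nonneg_of_le (fun k => h0 _) h hg.summable
  have hf : Summable f := (summable_nat_add_iff 8).1 hs
  refine ⟨∑' j, f j, hf.hasSum, hf.sum_le_tsum _ (fun j _ => h0 j), ?_⟩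
  rw [← hf.sum_add_tsum_nat_add 8]
  have := hasSum_le h hs.hasSum hg
  norm_num at this ⊢
  linarith

lemma FN (b : ℝ) (hb : 0 < b) (hb' : b ≤ 5.06) :
    ∃ F N : ℝ, HasSum (wgt b) F ∧ HasSum (fun j : ℕ => (j : ℝ) * wgt b j) N ∧
      ∑ j ∈ Finset.range 8, wgt b j ≤ F ∧ F ≤ ∑ j ∈ Finset.range 8, wgt b j + 0.019 ∧
      ∑ j ∈ Finset.range 8, (j : ℝ) * wgt b j ≤ N ∧
      N ≤ ∑ j ∈ Finset.range 8, (j : ℝ) * wgt b j + 0.019 := by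
  have h1 : ∀ k : ℕ, ((k + 8 : ℕ) : ℝ) * wgt b (k + 8) ≤ 0.014 * (1 / 4) ^ k := fun k =>
    (mul_le_mul_of_nonneg_left (wgt_mono hb.le hb' _) (Nat.cast_nonneg _)).trans (tail_term k)
  obtain ⟨N, hN, hN1, hN2⟩ := bounded_sum (f := fun j : ℕ => (j : ℝ) * wgt b j)
    (fun j => mul_nonneg (Nat.cast_nonneg _) (wgt_nonneg hb.le j)) h1
  obtain ⟨F, hF, hF1, hF2⟩ := bounded_sum (f := wgt b) (fun j => wgt_nonneg hb.le j) (fun k => by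
    refine le_trans ?_ (h1 k)
    refine le_mul_of_one_le_left (wgt_nonneg hb.le _) ?_
    push_cast; linarith [(Nat.cast_nonneg k : (0 : ℝ) ≤ k)])
  exact ⟨F, N, hF, hN, hF1, hF2, hN1, hN2⟩

lemma zeta_eq (lam mu : ℝ → ℝ) (x : ℝ) (j : ℕ) :
    zetaF lam mu x (1 + j) =
      zetaF lam mu x 1 * wgt (Real.exp (mu x - 3 / 2 * Real.log 2)) j := by
  induction j with
  | zero => simp [wgt]
  | succ j ih =>
    rw [wgt_succ, ← mul_assoc, ← ih]
    have : (2 : ℝ) ^ j = Real.exp (j * Real.log 2) := by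
      rw [Real.exp_nat_mul, Real.exp_log (by norm_num)]
    rw [this, ← Real.exp_sub]
    unfold zetaF
    rw [← Real.exp_add]
    congr 1
    push_cast
    ring

lemma log_bound {z : ℝ} (h0 : 0 < z) (h1 : z < 1) : z + z ^ 2 / 2 ≤ -Real.log (1 - z) := by
  have h := Real.hasSum_pow_div_log_of_abs_lt_one (x := z) (by rw [abs_of_pos h0]; exact h1)
  have := sum_le_hasSum (Finset.range 2) (fun j _ => by positivity) h
  norm_num [Finset.sum_range_succ] at this
  linarith

set_option maxHeartbeats 1000000 in
/-- Lemma 7.12: for `i₀ = s = 1`, `inf_{x ∈ [0.04,1]} φ(1, x, 1) > 0`. -/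
theorem phi_inf_pos_one (lam mu : ℝ → ℝ)
    (h1 : ∀ x ∈ Set.Icc (0:ℝ) 1, (∑' j : ℕ, zetaF lam mu x (1 + j)) = 1)
    (h2 : ∀ x ∈ Set.Icc (0:ℝ) 1,
      (∑' j : ℕ, ((1 + j : ℕ) : ℝ) * zetaF lam mu x (1 + j)) = Tfun x) :
    ∃ ε : ℝ, 0 < ε ∧ ∀ x ∈ Set.Icc (0.04:ℝ) 1, ε ≤ phiZ lam mu 1 1 x := by
  obtain ⟨F1, N1, hF1, hN1, hF1l, hF1u, hN1l, hN1u⟩ := FN 5.06 (by norm_num) le_rfl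
  obtain ⟨F2, N2, hF2, hN2, hF2l, hF2u, hN2l, hN2u⟩ := FN 2 (by norm_num) (by norm_num)
  norm_num [Finset.sum_range_succ, wgt, Nat.choose] at hF1l hF1u hN1l hN1u hF2l hF2u hN2l hN2u
  have hl1 := Real.log_two_gt_d9
  have hl2 := Real.log_two_lt_d9
  set h : ℝ := Real.log 2 / 2 with hh
  have hh0 : 0 < h := by rw [hh]; linarith
  set c : ℝ := 2 / Real.log 2 with hcdef
  have hhc : h * c = 1 := by rw [hh, hcdef]; field_simp
  have hc1 : 2.88539 < c := by
    rw [hcdef, lt_div_iff₀ (by linarith)]; linarith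
  have hc2 : c < 2.885391 := by
    rw [hcdef, div_lt_iff₀ (by linarith)]; linarith
  refine ⟨0.02 / 60 ^ 2, by norm_num, ?_⟩
  intro x hx
  obtain ⟨hx0, hx1⟩ := hx
  have hxI : x ∈ Set.Icc (0 : ℝ) 1 := ⟨by linarith, hx1⟩
  have e1 := h1 x hxI
  have e2 := h2 x hxI
  have hT : Tfun x = 1 + c - x := rfl
  set z := zetaF lam mu x 1 with hz
  have hz0 : 0 < z := Real.exp_pos _
  set a := Real.exp (mu x - 3 / 2 * Real.log 2) with ha
  have ha0 : 0 < a := Real.exp_pos _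
  have hs1 : HasSum (fun j : ℕ => zetaF lam mu x (1 + j)) 1 := by
    have : Summable (fun j : ℕ => zetaF lam mu x (1 + j)) := by
      by_contra hn
      rw [tsum_eq_zero_of_not_summable hn] at e1
      norm_num at e1
    rw [← e1]; exact this.hasSum
  have hs2 : HasSum (fun j : ℕ => ((1 + j : ℕ) : ℝ) * zetaF lam mu x (1 + j)) (1 + c - x) := by
    have : Summable (fun j : ℕ => ((1 + j : ℕ) : ℝ) * zetaF lam mu x (1 + j)) := by
      by_contra hn
      rw [tsum_eq_zero_of_not_summable hn, hT] at e2
      linarith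
    rw [← hT, ← e2]; exact this.hasSum
  obtain ⟨F, hF⟩ : ∃ F, F = z⁻¹ := ⟨_, rfl⟩
  have hzF : z * F = 1 := by rw [hF]; field_simp
  have hF0 : 0 < F := by rw [hF]; positivity
  have hsF : HasSum (wgt a) F := by
    have := hs1.mul_left F
    rw [mul_one] at this
    refine this.congr_fun ?_
    intro j
    rw [zeta_eq, ← hz, ← ha]
    linear_combination (- wgt a j) * hzF
  have hsN : HasSum (fun j : ℕ => (j : ℝ) * wgt a j) ((c - x) * F) := by
    have := (hs2.sub hs1).mul_left F
    rw [show F * (1 + c - x - 1) = (c - x) * F by ring] at this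
    refine this.congr_fun ?_
    intro j
    rw [zeta_eq, ← hz, ← ha]
    push_cast
    linear_combination (- (j : ℝ) * wgt a j) * hzF
  have ha1 : a ≤ 5.06 := by
    by_contra hcon
    push Not at hcon
    have hk := key (p := c - 0.04) (q := 1) (κ := 0) 2 (by norm_num) hcon.le
      (by intro j hj
          have : (j : ℝ) ≤ 2 := by exact_mod_cast hj
          simp only [ite_self]; linarith)
      (by intro j hj
          have : (3 : ℝ) ≤ j := by exact_mod_cast hj
          simp only [ite_self]; linarith) hF1 hN1 hsF hsN
    have hL : 0 ≤ (5.06 / a) ^ 2 * ((c - 0.04) * F - 1 * ((c - x) * F) - 0) := by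
      have : (c - 0.04) * F - 1 * ((c - x) * F) - 0 = (x - 0.04) * F := by ring
      rw [this]
      have : 0 ≤ x - 0.04 := by linarith
      positivity
    have : (c - 0.04) * F1 ≤ (2.885391 - 0.04) * F1 := by
      apply mul_le_mul_of_nonneg_right <;> linarith
    linarith
  have ha2 : 2 ≤ a := by
    by_contra hcon
    push Not at hcon
    have hk := key (p := c - 1) (q := 1) (κ := 0) 1 ha0 hcon.le
      (by intro j hj
          have : (j : ℝ) ≤ 1 := by exact_mod_cast hj
          simp only [ite_self]; linarith)
      (by intro j hj
          have : (2 : ℝ) ≤ j := by exact_mod_cast hj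
          simp only [ite_self]; linarith) hsF hsN hF2 hN2
    have h3 : 0 < (c - 1) * F2 - 1 * N2 - 0 := by
      have : (2.88539 - 1) * F2 ≤ (c - 1) * F2 := by
        apply mul_le_mul_of_nonneg_right <;> linarith
      linarith
    have h4 : (c - 1) * F - 1 * ((c - x) * F) - 0 ≤ 0 := by nlinarith
    have : 0 < (a / 2) ^ 1 * ((c - 1) * F2 - 1 * N2 - 0) := by positivity
    linarith
  have hS : 0.6 ≤ h * x * F := by
    have hk := key (p := 1) (q := h) (κ := 0.6) 2 ha0 ha1
      (by intro j hj
          interval_cases j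
          · norm_num
          · norm_num; linarith
          · norm_num; linarith)
      (by intro j hj
          have : (3 : ℝ) ≤ j := by exact_mod_cast hj
          have h0 : j ≠ 0 := by omega
          simp only [h0, if_false]; nlinarith) hsF hsN hF1 hN1
    have h3 : 0 ≤ 1 * F1 - h * N1 - 0.6 := by
      have : h * N1 ≤ 0.34657360 * N1 := by
        apply mul_le_mul_of_nonneg_right <;> linarith
      linarith
    have h4 : 1 * F - h * ((c - x) * F) - 0.6 = h * x * F - 0.6 := by
      linear_combination (-F) * hhc
    have : 0 ≤ (a / 5.06) ^ 2 * (1 * F1 - h * N1 - 0.6) := by positivity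
    linarith
  have hFl : 6.25 ≤ F := by
    have h3 : ∑ j ∈ Finset.range 5, wgt 2 j ≤ ∑ j ∈ Finset.range 5, wgt a j :=
      Finset.sum_le_sum (fun j _ => wgt_mono (by norm_num) ha2 j)
    have h4 := sum_le_hasSum (Finset.range 5) (fun j _ => wgt_nonneg ha0.le j) hsF
    have h5 : ∑ j ∈ Finset.range 5, wgt 2 j = 6.25 := by
      norm_num [Finset.sum_range_succ, wgt, Nat.choose]
    linarith
  have hFu : F ≤ 60 := by
    have := hasSum_le (fun j => wgt_mono ha0.le ha1 j) hsF hF1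
    linarith
  have hz1 : z ≤ 0.16 := by nlinarith
  have hz2 : 1 / 60 ≤ z := by nlinarith
  have hlog := log_bound hz0 (by linarith)
  have hphi : phiZ lam mu 1 1 x = (1 - z) * (-Real.log (1 - z)) - z + h * x * z := by
    unfold phiZ
    simp only [Finset.Icc_self, Finset.sum_singleton]
    rw [hT, ← hz, ← hh]
    push_cast
    linear_combination (-z) * hhc
  have hS2 : 0.6 * z ≤ h * x := by
    have : h * x = (h * x * F) * z := by linear_combination (-h * x) * hzF
    rw [this]; gcongr
  rw [hphi]
  have h6 : (1 - z) * (z + z ^ 2 / 2) ≤ (1 - z) * (-Real.log (1 - z)) :=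
    mul_le_mul_of_nonneg_left hlog (by linarith)
  have h7 : 0.6 * z * z ≤ h * x * z := mul_le_mul_of_nonneg_right hS2 hz0.le
  have h8 : (1 / 60 : ℝ) ^ 2 ≤ z ^ 2 := by gcongr
  have h9 : z ^ 2 * z ≤ z ^ 2 * 0.16 := by gcongr
  nlinarith
end
end
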